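/- If X ⊆ Homeo₊(I) is a finite geometrically fast set, then the group ⟨X⟩ generated by X embeds into Thompson's group F. -/

import Mathlib

open Set

/-- The unit interval `[0,1]` as a type. -/
abbrev UI : Type := ↥unitInterval

/-- Bijections of the unit interval; orientation-preserving homeomorphisms are
exactly the monotone ones among these. -/
abbrev Homeo01 : Type := Equiv.Perm UI

namespace PingPong

/-- The support of `f`. -/
def supt (f : Homeo01) : Set UI := {t | f t ≠ t}

/-- `f` is an orientation-preserving homeomorphism of `[0,1]`:
a monotone bijection of `[0,1]` (automatically a homeomorphism). -/
def IsOPH (f : Homeo01) : Prop := Monotone ⇑f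

/-- A bump function: an orientation preserving homeomorphism with exactly one
orbital, i.e. whose support is nonempty and connected. -/
def IsBump (f : Homeo01) : Prop := IsOPH f ∧ IsConnected (supt f)

/-- A positive bump function. -/
def IsPosBump (f : Homeo01) : Prop := IsBump f ∧ ∀ t ∈ supt f, t < f t

/-- The source of a positive bump `a` with marker `t`. -/
def src (a : Homeo01) (t : UI) : Set UI := {s ∈ supt a | s < t}

/-- The destination of a positive bump `a` with marker `t`. -/
def dest (a : Homeo01) (t : UI) : Set UI := {s ∈ supt a | a t ≤ s}

/-- `m` is a marking of the collection `A` of bumps. -/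
def IsMarking (A : Set Homeo01) (m : Homeo01 → UI) : Prop := ∀ a ∈ A, m a ∈ supt a

/-- The feet of a marked bump: `false` gives the source, `true` the destination. -/
def foot (a : Homeo01) (t : UI) : Bool → Set UI
  | false => src a t
  | true => dest a t

/-- The feet of the marked family `(A, m)` are pairwise disjoint. -/
def FeetDisjoint (A : Set Homeo01) (m : Homeo01 → UI) : Prop :=
  ∀ a ∈ A, ∀ b ∈ A, ∀ i j : Bool, (a, i) ≠ (b, j) →
    Disjoint (foot a (m a) i) (foot b (m b) j)

/-- A geometrically fast collection of (positive) bumps. -/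
def FastBumps (A : Set Homeo01) : Prop :=
  (∀ a ∈ A, IsPosBump a) ∧ ∃ m : Homeo01 → UI, IsMarking A m ∧ FeetDisjoint A m

/-- `t` is a left transition point of `f`. -/
def IsLeftTransition (f : Homeo01) (t : UI) : Prop :=
  t ∉ supt f ∧ ∀ ε : ℝ, 0 < ε → ∃ s ∈ supt f, t < s ∧ (s : ℝ) < (t : ℝ) + ε

/-- `t` is a right transition point of `f`. -/
def IsRightTransition (f : Homeo01) (t : UI) : Prop :=
  t ∉ supt f ∧ ∀ ε : ℝ, 0 < ε → ∃ s ∈ supt f, s < t ∧ (t : ℝ) - ε < (s : ℝ)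

/-- `t` is a transition point of `f`. -/
def IsTransition (f : Homeo01) (t : UI) : Prop :=
  IsLeftTransition f t ∨ IsRightTransition f t

/-- A geometrically proper set of homeomorphisms. -/
def GeomProper (X : Set Homeo01) : Prop :=
  (∀ f ∈ X, ∀ g ∈ X, f ≠ g → ∀ t : UI, ¬(IsLeftTransition f t ∧ IsLeftTransition g t)) ∧
  (∀ f ∈ X, ∀ g ∈ X, f ≠ g → ∀ t : UI, ¬(IsRightTransition f t ∧ IsRightTransition g t))

/-- The positive bump `a` is used in `f`. -/
def UsedIn (f a : Homeo01) : Prop :=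
  IsPosBump a ∧ (Set.EqOn ⇑f ⇑a (supt a) ∨ Set.EqOn ⇑f ⇑a⁻¹ (supt a))

/-- The set of (positive) bumps used in `X`. -/
def usedBumps (X : Set Homeo01) : Set Homeo01 := {a | ∃ f ∈ X, UsedIn f a}

/-- A geometrically fast set of homeomorphisms. -/
def GeomFast (X : Set Homeo01) : Prop := GeomProper X ∧ FastBumps (usedBumps X)

/-- The set of transition points of elements of `X`. -/
def transitionPoints (X : Set Homeo01) : Set UI := {t | ∃ f ∈ X, IsTransition f t}

/-! ### Words -/

/-- A word in the alphabet `A^± = A ∪ A⁻¹`, recorded as a list of the permutations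
represented by its symbols (for a set `A` of positive bumps this is faithful,
since `A ∩ A⁻¹ = ∅`). -/
def WordOn (A : Set Homeo01) (w : List Homeo01) : Prop := ∀ x ∈ w, x ∈ A ∨ x⁻¹ ∈ A

/-- A freely reduced word: no symbol is immediately followed by its inverse. -/
def FreelyReduced (w : List Homeo01) : Prop := List.Chain' (fun a b => b ≠ a⁻¹) w

/-- The right action of a word on a point: apply the symbols from left to right. -/
def act (t : UI) (w : List Homeo01) : UI := w.foldl (fun s a => a s) t

/-- `w` is locally reduced at `t`. -/
def LocallyReducedAt (w : List Homeo01) (t : UI) : Prop :=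
  FreelyReduced w ∧ ∀ (u : List Homeo01) (a : Homeo01), u ++ [a] <+: w → a (act t u) ≠ act t u

open Classical in
/-- The source of a symbol of `A^±`: for `a ∈ A` it is `src a`, and for the
formal inverse of an element of `A` it is the destination of that element. -/
noncomputable def symSrc (A : Set Homeo01) (m : Homeo01 → UI) (b : Homeo01) : Set UI :=
  if b ∈ A then src b (m b) else dest b⁻¹ (m b⁻¹)

open Classical in
/-- The destination of a symbol of `A^±`. -/
noncomputable def symDest (A : Set Homeo01) (m : Homeo01 → UI) (b : Homeo01) : Set UI :=
  if b ∈ A then dest b (m b) else src b⁻¹ (m b⁻¹)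

/-- The source of a word: the source of its first symbol (empty for the empty word). -/
noncomputable def wordSrc (A : Set Homeo01) (m : Homeo01 → UI) : List Homeo01 → Set UI
  | [] => ∅
  | a :: _ => symSrc A m a

/-- The destination of a word: the destination of its last symbol. -/
noncomputable def wordDest (A : Set Homeo01) (m : Homeo01 → UI) (w : List Homeo01) : Set UI :=
  match w.getLast? with
  | none => ∅
  | some a => symDest A m a

/-- `J(w) = supt(a) \ src(a)` where `a` is the first symbol of `w`. -/
noncomputable def Jset (A : Set Homeo01) (m : Homeo01 → UI) : List Homeo01 → Set UI
  | [] => ∅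
  | a :: _ => supt a \ symSrc A m a

/-- `t` has trivial history: it lies in no foot of any element of `A`. -/
def TrivialHistory (A : Set Homeo01) (m : Homeo01 → UI) (t : UI) : Prop :=
  ∀ a ∈ A, t ∉ src a (m a) ∧ t ∉ dest a (m a)

/-- `x` has finite history: there is a finite bound on the lengths of `A`-words
locally reduced at `x` whose evaluation at `x` is outside their destination. -/
def FiniteHistory (A : Set Homeo01) (m : Homeo01 → UI) (x : UI) : Prop :=
  ∃ n : ℕ, ∀ w : List Homeo01, WordOn A w → LocallyReducedAt w x →
    act x w ∉ wordDest A m w → w.length ≤ n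

/-- A return word for `x`. -/
def IsReturnWord (x : UI) (w : List Homeo01) : Prop := w ≠ [] ∧ act x w = x

/-- `w` has a return prefix for `x`. -/
def HasReturnPrefix (x : UI) (w : List Homeo01) : Prop :=
  ∃ v : List Homeo01, v <+: w ∧ IsReturnWord x v

/-- The set of initial markers of the marked family `(A, m)`. -/
def initialMarkers (A : Set Homeo01) (m : Homeo01 → UI) : Set UI :=
  {t | (∃ a ∈ A, m a = t) ∧ ∀ b ∈ A, m b < t → b (m b) ≠ t}

/-- `M⟨X⟩`: the orbit of the set of initial markers of `(A, m)` under the group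
generated by `X`. -/
def MOrbit (A : Set Homeo01) (m : Homeo01 → UI) (X : Set Homeo01) : Set UI :=
  {u | ∃ t ∈ initialMarkers A m, ∃ g ∈ Subgroup.closure X, g t = u}

end PingPong
namespace PingPong

/-! ### Piecewise linear maps and Thompson's group F -/

/-- `f` is piecewise linear (finitely many affine pieces). -/
def IsPL (f : Homeo01) : Prop :=
  ∃ (n : ℕ) (t : Fin (n + 1) → ℝ), StrictMono t ∧ t 0 = 0 ∧ t (Fin.last n) = 1 ∧
    ∀ i : Fin n, ∃ c d : ℝ, ∀ s : UI,
      t i.castSucc ≤ (s : ℝ) → (s : ℝ) ≤ t i.succ → ((f s : ℝ)) = c * (s : ℝ) + d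

/-- `x` is a dyadic rational. -/
def IsDyadic (x : ℝ) : Prop := ∃ (a : ℤ) (k : ℕ), x = (a : ℝ) / 2 ^ k

/-- `f` belongs to Thompson's group `F`: an orientation-preserving piecewise linear
homeomorphism of `[0,1]` with dyadic breakpoints and slopes integer powers of `2`. -/
def InThompsonF (f : Homeo01) : Prop :=
  IsOPH f ∧
  ∃ (n : ℕ) (t : Fin (n + 1) → ℝ), StrictMono t ∧ t 0 = 0 ∧ t (Fin.last n) = 1 ∧
    (∀ i, IsDyadic (t i)) ∧
    ∀ i : Fin n, ∃ (k : ℤ) (d : ℝ), ∀ s : UI,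
      t i.castSucc ≤ (s : ℝ) → (s : ℝ) ≤ t i.succ → ((f s : ℝ)) = (2 : ℝ) ^ k * (s : ℝ) + d

/-! ### Stretched transition chains -/

/-- `a` is isolated in `A`: its support contains no transition point of an element of `A`. -/
def IsolatedIn (A : Set Homeo01) (a : Homeo01) : Prop :=
  ∀ t ∈ supt a, ∀ b ∈ A, ¬ IsTransition b t

/-- `c` (with supports `(x i, y i)`) is a stretched transition chain of `A`. -/
def IsSTC (A : Set Homeo01) (k : ℕ) (c : Fin (k + 1) → Homeo01)
    (x y : Fin (k + 1) → ℝ) : Prop :=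
  (∀ i, c i ∈ A ∧ ¬ IsolatedIn A (c i)) ∧
  (∀ i, supt (c i) = {t : UI | x i < (t : ℝ) ∧ (t : ℝ) < y i}) ∧
  (∀ i : Fin k, x i.castSucc < x i.succ ∧ x i.succ < y i.castSucc ∧ y i.castSucc < y i.succ) ∧
  (∀ i : Fin k, ∀ t : UI, x i.succ < (t : ℝ) → (t : ℝ) < y i.castSucc →
    ∀ b ∈ A, ¬ IsTransition b t)

/-- `S` is the underlying set of some stretched transition chain of `A`. -/
def ChainSet (A : Set Homeo01) (S : Set Homeo01) : Prop :=
  ∃ (k : ℕ) (c : Fin (k + 1) → Homeo01) (x y : Fin (k + 1) → ℝ),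
    IsSTC A k c x y ∧ S = Set.range c

/-- `S` is the underlying set of a maximal stretched transition chain of `A`. -/
def MaxChainSet (A : Set Homeo01) (S : Set Homeo01) : Prop :=
  ChainSet A S ∧ ∀ S' : Set Homeo01, ChainSet A S' → S ⊆ S' → S = S'

/-- The transition points of `A` lying in the support of the chain `c`. -/
def chainTrans (A : Set Homeo01) (k : ℕ) (c : Fin (k + 1) → Homeo01) : Set UI :=
  {t | (∃ i, t ∈ supt (c i)) ∧ ∃ b ∈ A, IsTransition b t}

/-- The image of `t` under the composition `∏ C = c 0 ⋯ c k`. -/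
def chainApply (k : ℕ) (c : Fin (k + 1) → Homeo01) (t : UI) : UI :=
  (List.ofFn c).foldl (fun s a => a s) t

/-! ### Dynamical diagrams -/

/-- The collection of feet of the bumps used in `X`, with marking `m`. -/
def Feet (X : Set Homeo01) (m : Homeo01 → UI) : Set (Set UI) :=
  {S | ∃ a ∈ usedBumps X, S = src a (m a) ∨ S = dest a (m a)}

/-- The signed bumps of `f`: bumps agreeing with `f` on their support. -/
def signedBumps (f : Homeo01) : Set Homeo01 :=
  {b | IsBump b ∧ Set.EqOn ⇑b ⇑f (supt b)}

open Classical in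
/-- The source of a signed bump, with respect to the marking `m` of the positive bumps. -/
noncomputable def sSrc (m : Homeo01 → UI) (b : Homeo01) : Set UI :=
  if IsPosBump b then src b (m b) else dest b⁻¹ (m b⁻¹)

open Classical in
/-- The destination of a signed bump, with respect to the marking `m` of the positive bumps. -/
noncomputable def sDest (m : Homeo01 → UI) (b : Homeo01) : Set UI :=
  if IsPosBump b then dest b (m b) else src b⁻¹ (m b⁻¹)

/-- An isomorphism of the dynamical diagrams of the marked families `(X, mX)` and
`(Y, mY)`, inducing the bijection `τ : X → Y`: an order-preserving bijection `Φ`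
between the collections of feet, together with, for each `f ∈ X`, a bijection of the
signed bumps of `f` with those of `τ f` under which `Φ` matches sources with sources
and destinations with destinations. -/
def DiagIso (X : Set Homeo01) (mX : Homeo01 → UI) (Y : Set Homeo01) (mY : Homeo01 → UI)
    (τ : Homeo01 → Homeo01) : Prop :=
  Set.BijOn τ X Y ∧
  ∃ Φ : Set UI → Set UI,
    Set.BijOn Φ (Feet X mX) (Feet Y mY) ∧
    (∀ S ∈ Feet X mX, ∀ T ∈ Feet X mX,
      (∀ s ∈ S, ∀ t ∈ T, s < t) → ∀ s ∈ Φ S, ∀ t ∈ Φ T, s < t) ∧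
    ∀ f ∈ X, ∃ β : Homeo01 → Homeo01,
      Set.BijOn β (signedBumps f) (signedBumps (τ f)) ∧
      ∀ b ∈ signedBumps f, Φ (sSrc mX b) = sSrc mY (β b) ∧ Φ (sDest mX b) = sDest mY (β b)

/-! ### Excision -/

/-- The union of the supports of the bumps of `E` used in `f`. -/
def quotSupp (f : Homeo01) (E : Set Homeo01) : Set UI :=
  {t | ∃ a ∈ E, UsedIn f a ∧ t ∈ supt a}

/-- `g = f/E`: `g` is the identity on the supports of the bumps of `E` used in `f`,
and agrees with `f` elsewhere. -/
def IsQuot (f : Homeo01) (E : Set Homeo01) (g : Homeo01) : Prop :=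
  (∀ t ∈ quotSupp f E, g t = t) ∧ ∀ t ∉ quotSupp f E, g t = f t

/-- `E` is extraneous in `X` (with respect to the marking `m`), witnessed by an
interval `J`. -/
def Extraneous (X : Set Homeo01) (m : Homeo01 → UI) (E : Set Homeo01) : Prop :=
  ∃ J : Set UI, J.OrdConnected ∧ ∃ f ∈ X,
    (∀ e ∈ E, UsedIn f e ∧ IsolatedIn (usedBumps X) e ∧ supt e ⊆ J) ∧
    (∃ a : Homeo01, UsedIn f a ∧ a ∉ E ∧ (src a (m a) ⊆ J ∨ dest a (m a) ⊆ J)) ∧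
    ∀ g ∈ X, g ≠ f → ∀ b : Homeo01, UsedIn g b →
      Disjoint (src b (m b)) J ∧ Disjoint (dest b (m b)) J

end PingPong
namespace PingPong

/-! ### Abstract ping-pong systems -/

/-- Formal inversion of a signed symbol. -/
def flip {α : Type*} (s : α × Bool) : α × Bool := (s.1, !s.2)

@[simp] theorem flip_fst {α : Type*} (s : α × Bool) : (flip s).1 = s.1 := rfl

@[simp] theorem flip_flip {α : Type*} (s : α × Bool) : flip (flip s) = s := by
  simp [flip]

theorem flip_ne {α : Type*} (s : α × Bool) : flip s ≠ s := by
  rcases s with ⟨a, _ | _⟩ <;> simp [flip]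

/-- The permutation given by a signed generator. -/
def letterAct {J Ω : Type*} (g : J → Equiv.Perm Ω) (l : J × Bool) : Equiv.Perm Ω :=
  cond l.2 (g l.1) (g l.1)⁻¹

theorem letterAct_flip {J Ω : Type*} (g : J → Equiv.Perm Ω) (l : J × Bool) :
    letterAct g (flip l) = (letterAct g l)⁻¹ := by
  rcases l with ⟨j, _ | _⟩ <;> simp [letterAct, flip]

/-- A set `Ω` with permutations indexed by `J`, decomposed into bumps indexed by `ι`, whose
signed bumps play ping-pong: `foot (i, b)` is the destination of the signed bump `(i, b)`. -/
structure FastSystem (J ι Ω : Type*) where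
  gen : J → Equiv.Perm Ω
  label : ι × Bool → J × Bool
  label_flip : ∀ s, label (flip s) = flip (label s)
  orb : ι → Set Ω
  foot : ι × Bool → Set Ω
  foot_nonempty : ∀ s, (foot s).Nonempty
  foot_disjoint : ∀ s t, ∀ z ∈ foot s, z ∈ foot t → s = t
  foot_subset : ∀ s, foot s ⊆ orb s.1
  foot_subset_of_mem : ∀ s i, ∀ z ∈ foot s, z ∈ orb i → foot s ⊆ orb i
  orb_disjoint : ∀ s t, label s = label t → ∀ z ∈ orb s.1, z ∈ orb t.1 → s = t
  exists_mid : ∀ i, ∃ z ∈ orb i, ∀ b, z ∉ foot (i, b)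
  image_foot : ∀ s, letterAct gen (label s) '' (orb s.1 \ foot (flip s)) = foot s
  fix : ∀ l, ∀ z, (∀ s, label s = l → z ∉ orb s.1) → letterAct gen l z = z

namespace FastSystem

variable {J ι Ω : Type*} (F : FastSystem J ι Ω)

/-- A cell is a foot or a single point. -/
def cell : (ι × Bool) ⊕ Ω → Set Ω
  | Sum.inl s => F.foot s
  | Sum.inr z => {z}

/-- A proper cell is a foot or a single point outside all feet. -/
def IsCell : (ι × Bool) ⊕ Ω → Prop
  | Sum.inl _ => True
  | Sum.inr z => ∀ s, z ∉ F.foot s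

theorem cell_nonempty (b : (ι × Bool) ⊕ Ω) : (F.cell b).Nonempty := by
  cases b with
  | inl s => exact F.foot_nonempty s
  | inr z => exact ⟨z, rfl⟩

theorem exists_cell (z : Ω) : ∃ b, F.IsCell b ∧ z ∈ F.cell b := by
  by_cases h : ∃ s, z ∈ F.foot s
  · obtain ⟨s, hs⟩ := h
    exact ⟨Sum.inl s, trivial, hs⟩
  · exact ⟨Sum.inr z, fun s hs => h ⟨s, hs⟩, rfl⟩

theorem cell_subset_of_mem {b : (ι × Bool) ⊕ Ω} {i : ι} {z : Ω} (hz : z ∈ F.cell b)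
    (hi : z ∈ F.orb i) : F.cell b ⊆ F.orb i := by
  cases b with
  | inl s => exact F.foot_subset_of_mem s i z hz hi
  | inr y =>
    rintro w rfl
    rwa [show z = w from hz] at hi

/-- The topmost cell of a stack of signed bumps resting on the cell `b`. -/
def top (b : (ι × Bool) ⊕ Ω) : List (ι × Bool) → (ι × Bool) ⊕ Ω
  | [] => b
  | s :: _ => Sum.inl s

/-- The stack is a locally reduced word, read from its last entry, at the points of the cell `b`. -/
def Valid (b : (ι × Bool) ⊕ Ω) : List (ι × Bool) → Prop
  | [] => True
  | s :: l => F.cell (top b l) ⊆ F.orb s.1 ∧ top b l ≠ Sum.inl (flip s) ∧ Valid b l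

/-- The image of a point under the word recorded by a stack. -/
def eval (z : Ω) : List (ι × Bool) → Ω
  | [] => z
  | s :: l => letterAct F.gen (F.label s) (eval z l)

/-- The effect of a signed generator on a stack. -/
def Step (b : (ι × Bool) ⊕ Ω) (a : J × Bool) (l l' : List (ι × Bool)) : Prop :=
  (l' = l ∧ ∀ s, F.label s = a → ¬ F.cell (top b l) ⊆ F.orb s.1) ∨
  (∃ s, F.label s = a ∧ l' = s :: l ∧ F.Valid b (s :: l)) ∨
  (∃ s, l = s :: l' ∧ F.label (flip s) = a)

/-- The effect of a word, acting from its last letter, on a stack. -/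
def Run (b : (ι × Bool) ⊕ Ω) : List (J × Bool) → List (ι × Bool) → List (ι × Bool) → Prop
  | [], l, l' => l' = l
  | a :: w, l, l' => ∃ k, Run b w l k ∧ F.Step b a k l'

/-- The action of a word in the signed generators. -/
def wordAct (w : List (J × Bool)) : Equiv.Perm Ω := (w.map (letterAct F.gen)).prod

variable {F}

theorem letterAct_mem_foot {s : ι × Bool} {b : (ι × Bool) ⊕ Ω} (hb : F.IsCell b)
    (h : F.cell b ⊆ F.orb s.1) (hne : b ≠ Sum.inl (flip s)) {z : Ω} (hz : z ∈ F.cell b) :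
    letterAct F.gen (F.label s) z ∈ F.foot s := by
  rw [← F.image_foot s]
  refine ⟨z, ⟨h hz, fun hz' => ?_⟩, rfl⟩
  cases b with
  | inl t => exact hne (by rw [F.foot_disjoint _ _ z hz hz'])
  | inr y => exact hb _ (by rwa [show z = y from hz] at hz')

theorem isCell_top {b : (ι × Bool) ⊕ Ω} (hb : F.IsCell b) (l : List (ι × Bool)) :
    F.IsCell (top b l) := by
  cases l with
  | nil => exact hb
  | cons s l => exact trivial

theorem eval_mem {b : (ι × Bool) ⊕ Ω} (hb : F.IsCell b) {z : Ω} (hz : z ∈ F.cell b)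
    {l : List (ι × Bool)} (hl : F.Valid b l) : F.eval z l ∈ F.cell (top b l) := by
  induction l with
  | nil => exact hz
  | cons s l ih => exact letterAct_mem_foot (isCell_top hb l) hl.1 hl.2.1 (ih hl.2.2)

theorem Step.valid {b : (ι × Bool) ⊕ Ω} {a : J × Bool} {l l' : List (ι × Bool)}
    (h : F.Step b a l l') (hl : F.Valid b l) : F.Valid b l' := by
  rcases h with ⟨rfl, -⟩ | ⟨s, -, rfl, h⟩ | ⟨s, rfl, -⟩
  · exact hl
  · exact h
  · exact hl.2.2

theorem Step.eval_eq {b : (ι × Bool) ⊕ Ω} (hb : F.IsCell b) {a : J × Bool}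
    {l l' : List (ι × Bool)} (h : F.Step b a l l') (hl : F.Valid b l) {z : Ω}
    (hz : z ∈ F.cell b) : letterAct F.gen a (F.eval z l) = F.eval z l' := by
  rcases h with ⟨rfl, h⟩ | ⟨s, rfl, rfl, -⟩ | ⟨s, rfl, rfl⟩
  · exact F.fix a _ fun s hs hmem => h s hs (F.cell_subset_of_mem (eval_mem hb hz hl) hmem)
  · rfl
  · simp [eval, F.label_flip, letterAct_flip]

theorem exists_step {b : (ι × Bool) ⊕ Ω} (a : J × Bool) {l : List (ι × Bool)}
    (hl : F.Valid b l) (hdepth : l ≠ [] ∨ ∃ z, b = Sum.inr z) :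
    ∃ l', F.Step b a l l' ∧ l.length ≤ l'.length + 1 := by
  by_cases h : ∃ s, F.label s = a ∧ F.cell (top b l) ⊆ F.orb s.1
  · obtain ⟨s, hs, hsub⟩ := h
    by_cases hne : top b l = Sum.inl (flip s)
    · cases l with
      | nil =>
        obtain ⟨z, rfl⟩ := hdepth.resolve_left (by simp)
        simp [top] at hne
      | cons t l =>
        refine ⟨l, Or.inr (Or.inr ⟨t, rfl, ?_⟩), by simp⟩
        have : t = flip s := by simpa [top] using hne
        rw [this, flip_flip, hs]
    · exact ⟨s :: l, Or.inr (Or.inl ⟨s, hs, rfl, hsub, hne, hl⟩), by simp; omega⟩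
  · exact ⟨l, Or.inl ⟨rfl, fun s hs hsub => h ⟨s, hs, hsub⟩⟩, by omega⟩

theorem Run.valid {b : (ι × Bool) ⊕ Ω} {w : List (J × Bool)} {l l' : List (ι × Bool)}
    (h : F.Run b w l l') (hl : F.Valid b l) : F.Valid b l' := by
  induction w generalizing l' with
  | nil => obtain rfl : l' = l := h; exact hl
  | cons a w ih => obtain ⟨k, hk, hs⟩ := h; exact hs.valid (ih hk)

theorem Run.eval_eq {b : (ι × Bool) ⊕ Ω} (hb : F.IsCell b) {w : List (J × Bool)}
    {l l' : List (ι × Bool)} (h : F.Run b w l l') (hl : F.Valid b l) {z : Ω}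
    (hz : z ∈ F.cell b) : F.wordAct w (F.eval z l) = F.eval z l' := by
  induction w generalizing l' with
  | nil => obtain rfl : l' = l := h; simp [wordAct]
  | cons a w ih =>
    obtain ⟨k, hk, hs⟩ := h
    rw [← hs.eval_eq hb (hk.valid hl) hz, ← ih hk]
    simp [wordAct]

theorem exists_run {b : (ι × Bool) ⊕ Ω} (w : List (J × Bool)) {l : List (ι × Bool)}
    (hl : F.Valid b l) (hdepth : w.length ≤ l.length ∨ ∃ z, b = Sum.inr z) :
    ∃ l', F.Run b w l l' ∧ l.length ≤ l'.length + w.length := by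
  induction w with
  | nil => exact ⟨l, rfl, by simp⟩
  | cons a w ih =>
    rw [List.length_cons] at hdepth
    obtain ⟨k, hk, hlen⟩ := ih (hdepth.imp_left (by omega))
    obtain ⟨l', hs, hlen'⟩ := exists_step a (hk.valid hl) (hdepth.imp_left fun h h0 => by
      subst h0; simp at hlen; omega)
    exact ⟨l', ⟨k, hk, hs⟩, by rw [List.length_cons]; omega⟩

theorem top_append (b : (ι × Bool) ⊕ Ω) (l : List (ι × Bool)) (s : ι × Bool) :
    top b (l ++ [s]) = top (Sum.inl s) l := by
  cases l <;> rfl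

theorem eval_append (z : Ω) (l : List (ι × Bool)) (s : ι × Bool) :
    F.eval z (l ++ [s]) = F.eval (letterAct F.gen (F.label s) z) l := by
  induction l with
  | nil => rfl
  | cons t l ih => simp [eval, ih]

theorem valid_append {b : (ι × Bool) ⊕ Ω} {s : ι × Bool} (hs : F.Valid b [s])
    {l : List (ι × Bool)} (hl : F.Valid (Sum.inl s) l) : F.Valid b (l ++ [s]) := by
  induction l with
  | nil => exact hs
  | cons t l ih =>
    refine ⟨?_, ?_, ih hl.2.2⟩
    · exact (top_append b l s).symm ▸ hl.1
    · exact (top_append b l s).symm ▸ hl.2.1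

/-- Every point has a history of any prescribed depth, unless its history is finite. -/
theorem exists_history (x : Ω) (n : ℕ) :
    ∃ b l z, F.IsCell b ∧ F.Valid b l ∧ z ∈ F.cell b ∧ F.eval z l = x ∧
      (n ≤ l.length ∨ ∃ y, b = Sum.inr y) := by
  induction n with
  | zero =>
    obtain ⟨b, hb, hx⟩ := F.exists_cell x
    exact ⟨b, [], x, hb, trivial, hx, rfl, Or.inl (by simp)⟩
  | succ n ih =>
    obtain ⟨b, l, z, hb, hl, hz, hx, hn⟩ := ih
    rcases b with s | y
    · have hz' : z ∈ F.foot s := hz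
      rw [← F.image_foot s] at hz'
      obtain ⟨z₀, ⟨h₁, h₂⟩, rfl⟩ := hz'
      obtain ⟨c, hc, hzc⟩ := F.exists_cell z₀
      refine ⟨c, l ++ [s], z₀, hc, valid_append ⟨F.cell_subset_of_mem hzc h₁, ?_, trivial⟩ hl,
        hzc, by rw [eval_append, hx], Or.inl ?_⟩
      · rintro rfl
        exact h₂ hzc
      · have := hn.resolve_right (by simp)
        simpa using this
    · exact ⟨_, l, z, hb, hl, hz, hx, Or.inr ⟨y, rfl⟩⟩

theorem exists_mem_foot_notMem_image (s t : ι × Bool) :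
    ∃ p ∈ F.foot s, p ∉ letterAct F.gen (F.label s) '' F.foot t := by
  obtain ⟨z, hz, hzs, hzt⟩ : ∃ z ∈ F.orb s.1, z ∉ F.foot (flip s) ∧ z ∉ F.foot t := by
    by_cases hst : t = s
    · obtain ⟨z, hz, hz'⟩ := F.exists_mid s.1
      exact ⟨z, hz, hz' _, hst ▸ hz' s.2⟩
    · obtain ⟨z, hz⟩ := F.foot_nonempty s
      exact ⟨z, F.foot_subset s hz, fun h' => flip_ne s (F.foot_disjoint _ _ z h' hz),
        fun h' => hst (F.foot_disjoint _ _ z h' hz)⟩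
  refine ⟨letterAct F.gen (F.label s) z, ?_, ?_⟩
  · rw [← F.image_foot s]
    exact ⟨z, ⟨hz, hzs⟩, rfl⟩
  · rintro ⟨w, hw, he⟩
    exact hzt ((letterAct F.gen (F.label s)).injective he ▸ hw)

theorem exists_eval_ne_of_cons {b : (ι × Bool) ⊕ Ω} (hb : F.IsCell b) {s : ι × Bool}
    {l : List (ι × Bool)} (hl : F.Valid b (s :: l)) :
    ∃ z ∈ F.cell b, F.eval z (s :: l) ≠ z := by
  by_contra! hcon
  obtain ⟨z, hz⟩ := F.cell_nonempty b
  have hzs : z ∈ F.foot s := hcon z hz ▸ eval_mem hb hz hl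
  rcases b with c | y
  · obtain rfl := F.foot_disjoint _ _ z hz hzs
    obtain ⟨t, ht⟩ : ∃ t, top (Sum.inl c : (ι × Bool) ⊕ Ω) l = Sum.inl t := by
      cases l with
      | nil => exact ⟨_, rfl⟩
      | cons t l => exact ⟨t, rfl⟩
    obtain ⟨p, hp, hp'⟩ := exists_mem_foot_notMem_image (F := F) c t
    refine hp' ⟨F.eval p l, ?_, hcon p hp⟩
    have := eval_mem hb hp hl.2.2
    rwa [ht] at this
  · exact hb s ((show z = y from hz) ▸ hzs)

/-- Distinct valid stacks on the same cell act differently on it. -/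
theorem exists_eval_ne {b : (ι × Bool) ⊕ Ω} (hb : F.IsCell b) {l l' : List (ι × Bool)}
    (hl : F.Valid b l) (hl' : F.Valid b l') (hne : l ≠ l') :
    ∃ z ∈ F.cell b, F.eval z l ≠ F.eval z l' := by
  induction l generalizing l' with
  | nil =>
    cases l' with
    | nil => exact absurd rfl hne
    | cons s l' =>
      obtain ⟨z, hz, h⟩ := exists_eval_ne_of_cons hb hl'
      exact ⟨z, hz, h.symm⟩
  | cons s l ih =>
    cases l' with
    | nil => exact exists_eval_ne_of_cons hb hl
    | cons s' l' =>
      by_cases hs : s = s'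
      · subst hs
        obtain ⟨z, hz, h⟩ := ih hl.2.2 hl'.2.2 fun h => hne (h ▸ rfl)
        exact ⟨z, hz, fun he => h ((letterAct F.gen (F.label s)).injective he)⟩
      · obtain ⟨z, hz⟩ := F.cell_nonempty b
        refine ⟨z, hz, fun he => hs (F.foot_disjoint _ _ _ (eval_mem hb hz hl) ?_)⟩
        rw [he]
        exact eval_mem hb hz hl'

/-- A valid stack is determined by its bottom cell and its labels. -/
theorem eq_of_map_label_eq {b : (ι × Bool) ⊕ Ω} {l l' : List (ι × Bool)}
    (hl : F.Valid b l) (hl' : F.Valid b l') (h : l.map F.label = l'.map F.label) : l = l' := by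
  induction l generalizing l' with
  | nil => simpa using h.symm
  | cons s l ih =>
    cases l' with
    | nil => simp at h
    | cons s' l' =>
      simp only [List.map_cons, List.cons.injEq] at h
      obtain rfl := ih hl.2.2 hl'.2.2 h.2
      obtain ⟨z, hz⟩ := F.cell_nonempty (top b l)
      rw [F.orb_disjoint s s' h.1 z (hl.1 hz) (hl'.1 hz)]

variable {ι' Ω' : Type*} {F' : FastSystem J ι' Ω'}

variable (F F') in
/-- A left-total simulation between the cells of two systems with the same generators. -/
structure Simulation where
  rel : (ι × Bool) ⊕ Ω → (ι' × Bool) ⊕ Ω' → Prop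
  exists_rel : ∀ b, F.IsCell b → ∃ b', F'.IsCell b' ∧ rel b b'
  exists_label : ∀ s b', rel (Sum.inl s) b' → ∃ s', b' = Sum.inl s' ∧ F.label s = F'.label s'
  push : ∀ b b', rel b b' → ∀ s, F.cell b ⊆ F.orb s.1 → b ≠ Sum.inl (flip s) →
    ∃ s', F'.cell b' ⊆ F'.orb s'.1 ∧ b' ≠ Sum.inl (flip s') ∧ rel (Sum.inl s) (Sum.inl s')
  stay : ∀ b b', rel b b' → ∀ s', F'.cell b' ⊆ F'.orb s'.1 →
    ∃ s, F.label s = F'.label s' ∧ F.cell b ⊆ F.orb s.1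

namespace Simulation

section

variable (R : Simulation F F')

/-- Two stacks are related when their entries are. -/
def StackRel : List (ι × Bool) → List (ι' × Bool) → Prop :=
  List.Forall₂ fun s s' => R.rel (Sum.inl s) (Sum.inl s')

theorem label_eq {s : ι × Bool} {s' : ι' × Bool} (h : R.rel (Sum.inl s) (Sum.inl s')) :
    F.label s = F'.label s' := by
  obtain ⟨t, ht, hl⟩ := R.exists_label _ _ h
  rw [hl, Sum.inl_injective ht]

theorem map_label_eq {l : List (ι × Bool)} {l' : List (ι' × Bool)} (h : R.StackRel l l') :
    l.map F.label = l'.map F'.label := by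
  induction h with
  | nil => rfl
  | cons h _ ih => rw [List.map_cons, List.map_cons, ih, R.label_eq h]

theorem rel_top {b : (ι × Bool) ⊕ Ω} {b' : (ι' × Bool) ⊕ Ω'} (hb : R.rel b b')
    {l : List (ι × Bool)} {l' : List (ι' × Bool)} (h : R.StackRel l l') :
    R.rel (top b l) (top b' l') := by
  cases h with
  | nil => exact hb
  | cons h _ => exact h

theorem exists_cons {b : (ι × Bool) ⊕ Ω} {b' : (ι' × Bool) ⊕ Ω'} (hb : R.rel b b')
    {s : ι × Bool} {l : List (ι × Bool)} {l' : List (ι' × Bool)} (h : R.StackRel l l')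
    (hl : F.Valid b (s :: l)) (hl' : F'.Valid b' l') :
    ∃ s', R.StackRel (s :: l) (s' :: l') ∧ F'.Valid b' (s' :: l') := by
  obtain ⟨s', h₁, h₂, h₃⟩ := R.push _ _ (R.rel_top hb h) s hl.1 hl.2.1
  exact ⟨s', List.Forall₂.cons h₃ h, h₁, h₂, hl'⟩

theorem exists_stack {b : (ι × Bool) ⊕ Ω} {b' : (ι' × Bool) ⊕ Ω'} (hb : R.rel b b')
    {l : List (ι × Bool)} (hl : F.Valid b l) : ∃ l', R.StackRel l l' ∧ F'.Valid b' l' := by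
  induction l with
  | nil => exact ⟨[], List.Forall₂.nil, trivial⟩
  | cons s l ih =>
    obtain ⟨l', h, hl'⟩ := ih hl.2.2
    obtain ⟨s', h'⟩ := R.exists_cons hb h hl hl'
    exact ⟨_, h'⟩

theorem exists_step {b : (ι × Bool) ⊕ Ω} {b' : (ι' × Bool) ⊕ Ω'} (hb : R.rel b b')
    {a : J × Bool} {l k : List (ι × Bool)} {l' : List (ι' × Bool)} (h : R.StackRel l l')
    (hl' : F'.Valid b' l') (hs : F.Step b a l k) : ∃ k', R.StackRel k k' ∧ F'.Step b' a l' k' := by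
  rcases hs with ⟨rfl, hs⟩ | ⟨s, hs, rfl, hv⟩ | ⟨s, rfl, hs⟩
  · refine ⟨l', h, Or.inl ⟨rfl, fun s' hs' hsub => ?_⟩⟩
    obtain ⟨s, hs₁, hs₂⟩ := R.stay _ _ (R.rel_top hb h) s' hsub
    exact hs s (hs₁.trans hs') hs₂
  · obtain ⟨s', h₁, h₂⟩ := R.exists_cons hb h hv hl'
    refine ⟨_, h₁, Or.inr (Or.inl ⟨s', ?_, rfl, h₂⟩)⟩
    rw [← hs]
    exact (R.label_eq (List.forall₂_cons.1 h₁).1).symm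
  · cases h with
    | @cons _ s' _ k' h hk =>
      refine ⟨k', hk, Or.inr (Or.inr ⟨s', rfl, ?_⟩)⟩
      rw [F'.label_flip, ← R.label_eq h, ← F.label_flip, hs]

theorem exists_run {b : (ι × Bool) ⊕ Ω} {b' : (ι' × Bool) ⊕ Ω'} (hb : R.rel b b')
    {w : List (J × Bool)} {l k : List (ι × Bool)} {l' : List (ι' × Bool)} (h : R.StackRel l l')
    (hl' : F'.Valid b' l') (hr : F.Run b w l k) : ∃ k', R.StackRel k k' ∧ F'.Run b' w l' k' := by
  induction w generalizing k with
  | nil =>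
    obtain rfl : k = l := hr
    exact ⟨l', h, rfl⟩
  | cons a w ih =>
    obtain ⟨j, hj, hs⟩ := hr
    obtain ⟨j', hjj, hj'⟩ := ih hj
    obtain ⟨k', hk, hs'⟩ := R.exists_step hb hjj (hj'.valid hl') hs
    exact ⟨k', hk, j', hj', hs'⟩

end

/-- A word acting trivially on the target of a simulation acts trivially on its source. -/
theorem wordAct_eq_one (R : Simulation F F') {w : List (J × Bool)} (hw : F'.wordAct w = 1) :
    F.wordAct w = 1 := by
  by_contra hne
  obtain ⟨x, hx⟩ : ∃ x, F.wordAct w x ≠ x := by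
    by_contra! h
    exact hne (Equiv.ext h)
  obtain ⟨b, l, z, hb, hl, hz, rfl, hn⟩ := exists_history (F := F) x w.length
  obtain ⟨k, hk, -⟩ := FastSystem.exists_run w hl hn
  obtain ⟨b', hb', hbb⟩ := R.exists_rel b hb
  obtain ⟨l', hll, hl'⟩ := R.exists_stack hbb hl
  obtain ⟨k', hkk, hk'⟩ := R.exists_run hbb hll hl' hk
  rw [hk.eval_eq hb hl hz] at hx
  have hlk : l' ≠ k' := by
    rintro rfl
    exact hx (by rw [eq_of_map_label_eq hl (hk.valid hl)
      ((R.map_label_eq hll).trans (R.map_label_eq hkk).symm)])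
  obtain ⟨z', hz', hzne⟩ := exists_eval_ne hb' hl' (hk'.valid hl') hlk
  apply hzne
  rw [← hk'.eval_eq hb' hl' hz', hw]
  rfl

end Simulation

end FastSystem

/-! ### Families of bumps on a linear order -/

theorem letterAct_strictMono {J Ω : Type*} [LinearOrder Ω] {g : J → Equiv.Perm Ω}
    (hg : ∀ j, Monotone (g j)) (l : J × Bool) : StrictMono (letterAct g l) := by
  have h : ∀ j, StrictMono (g j) := fun j => (hg j).strictMono_of_injective (g j).injective
  rcases l with ⟨j, _ | _⟩
  · intro a b hab
    by_contra! hle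
    have := hg j hle
    simp [letterAct] at this
    exact absurd hab (not_lt.2 this)
  · exact h j

/-- Monotone permutations of a linear order whose orbitals are the intervals `Ioo (x i) (y i)`,
with markers `m i` sent to `d i`, such that the feet `Ioo (x i) (m i)` and `Ico (d i) (y i)` are
pairwise disjoint. -/
structure BumpFamily (J ι Ω : Type*) [LinearOrder Ω] where
  gen : J → Equiv.Perm Ω
  gen_mono : ∀ j, Monotone (gen j)
  lab : ι → J × Bool
  x : ι → Ω
  m : ι → Ω
  d : ι → Ω
  y : ι → Ω
  x_lt_m : ∀ i, x i < m i
  m_lt_d : ∀ i, m i < d i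
  d_lt_y : ∀ i, d i < y i
  foot_le : ∀ s t : ι × Bool, s ≠ t →
    cond s.2 (y s.1) (m s.1) ≤ cond t.2 (d t.1) (x t.1) ∨
      cond t.2 (y t.1) (m t.1) ≤ cond s.2 (d s.1) (x s.1)
  orb_le : ∀ i j, i ≠ j → (lab i).1 = (lab j).1 → y i ≤ x j ∨ y j ≤ x i
  act_x : ∀ i, letterAct gen (lab i) (x i) = x i
  act_m : ∀ i, letterAct gen (lab i) (m i) = d i
  act_y : ∀ i, letterAct gen (lab i) (y i) = y i
  fix : ∀ j z, (∀ i, (lab i).1 = j → z ∉ Ioo (x i) (y i)) → gen j z = z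

namespace BumpFamily

section

variable {J ι Ω : Type*} [LinearOrder Ω] (B : BumpFamily J ι Ω)

/-- The left end of a foot. -/
def lo (s : ι × Bool) : Ω := cond s.2 (B.d s.1) (B.x s.1)

/-- The right end of a foot. -/
def hi (s : ι × Bool) : Ω := cond s.2 (B.y s.1) (B.m s.1)

/-- The foot of a signed bump. -/
def foot (s : ι × Bool) : Set Ω := cond s.2 (Ico (B.d s.1) (B.y s.1)) (Ioo (B.x s.1) (B.m s.1))

/-- The generator, or its inverse, that acts as the given signed bump. -/
def label (s : ι × Bool) : J × Bool := ((B.lab s.1).1, s.2 == (B.lab s.1).2)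

theorem label_true (i : ι) : B.label (i, true) = B.lab i := by
  simp [label]

theorem label_flip (s : ι × Bool) : B.label (flip s) = flip (B.label s) := by
  rcases s with ⟨i, b⟩
  simp only [label, flip, Prod.mk.injEq, true_and]
  cases b <;> cases (B.lab i).2 <;> rfl

theorem Ioo_subset_foot (s : ι × Bool) : Ioo (B.lo s) (B.hi s) ⊆ B.foot s := by
  rcases s with ⟨i, _ | _⟩
  · exact subset_rfl
  · exact Ioo_subset_Ico_self

theorem foot_subset_Ico (s : ι × Bool) : B.foot s ⊆ Ico (B.lo s) (B.hi s) := by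
  rcases s with ⟨i, _ | _⟩
  · exact Ioo_subset_Ico_self
  · exact subset_rfl

theorem x_le_lo (s : ι × Bool) : B.x s.1 ≤ B.lo s := by
  rcases s with ⟨i, _ | _⟩
  · exact le_rfl
  · exact ((B.x_lt_m i).trans (B.m_lt_d i)).le

theorem hi_le_y (s : ι × Bool) : B.hi s ≤ B.y s.1 := by
  rcases s with ⟨i, _ | _⟩
  · exact ((B.m_lt_d i).trans (B.d_lt_y i)).le
  · exact le_rfl

theorem lo_lt_hi (s : ι × Bool) : B.lo s < B.hi s := by
  rcases s with ⟨i, _ | _⟩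
  · exact B.x_lt_m i
  · exact B.d_lt_y i

theorem m_lt_y (i : ι) : B.m i < B.y i := (B.m_lt_d i).trans (B.d_lt_y i)

theorem x_lt_d (i : ι) : B.x i < B.d i := (B.x_lt_m i).trans (B.m_lt_d i)

theorem x_lt_y (i : ι) : B.x i < B.y i := (B.x_lt_m i).trans (B.m_lt_y i)

theorem hi_le_lo {s t : ι × Bool} (h : s ≠ t) : B.hi s ≤ B.lo t ∨ B.hi t ≤ B.lo s :=
  B.foot_le s t h

theorem foot_subset (s : ι × Bool) : B.foot s ⊆ Ioo (B.x s.1) (B.y s.1) := by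
  rcases s with ⟨i, _ | _⟩
  · exact Ioo_subset_Ioo_right (B.m_lt_y i).le
  · exact fun z hz => ⟨(B.x_lt_d i).trans_le hz.1, hz.2⟩

/-- The foot of `s` lies between the feet of `i`, or is one of them. -/
def Inside (s : ι × Bool) (i : ι) : Prop := B.x i ≤ B.lo s ∧ B.hi s ≤ B.y i

theorem inside_self (s : ι × Bool) : B.Inside s s.1 := ⟨B.x_le_lo s, B.hi_le_y s⟩

theorem Inside.foot_subset {s : ι × Bool} {i : ι} (h : B.Inside s i) :
    B.foot s ⊆ Ioo (B.x i) (B.y i) := by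
  by_cases hs : s.1 = i
  · subst hs
    exact B.foot_subset s
  · intro z hz
    have hz' := B.foot_subset_Ico s hz
    refine ⟨?_, hz'.2.trans_le h.2⟩
    rcases B.hi_le_lo (s := s) (t := (i, false)) (fun e => hs (by rw [e])) with h' | h'
    · have : B.lo (i, false) = B.x i := rfl
      exact absurd (B.lo_lt_hi s) (not_lt.2 (h'.trans (this ▸ h.1)))
    · exact (B.x_lt_m i).trans_le (h'.trans hz'.1)

theorem inside_of_mem {s : ι × Bool} {i : ι} {z : Ω} (hz : z ∈ Ico (B.lo s) (B.hi s))
    (hi : z ∈ Ioo (B.x i) (B.y i)) : B.Inside s i := by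
  constructor
  · by_cases hs : s = (i, false)
    · subst hs
      exact le_rfl
    · rcases B.hi_le_lo hs with h | h
      · exact absurd (hz.2.trans_le h) (not_lt.2 hi.1.le)
      · exact (B.x_lt_m i).le.trans h
  · by_cases hs : s = (i, true)
    · subst hs
      exact le_rfl
    · rcases B.hi_le_lo hs with h | h
      · exact h.trans (B.d_lt_y i).le
      · exact absurd (h.trans hz.1) (not_le.2 hi.2)

theorem foot_disjoint {s t : ι × Bool} {z : Ω} (hs : z ∈ B.foot s) (ht : z ∈ B.foot t) :
    s = t := by
  by_contra h
  have hs := B.foot_subset_Ico s hs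
  have ht := B.foot_subset_Ico t ht
  rcases B.hi_le_lo h with h | h
  · exact absurd (hs.2.trans_le (h.trans ht.1)) (lt_irrefl _)
  · exact absurd (ht.2.trans_le (h.trans hs.1)) (lt_irrefl _)

theorem image_foot (s : ι × Bool) : letterAct B.gen (B.label s) ''
    (Ioo (B.x s.1) (B.y s.1) \ B.foot (flip s)) = B.foot s := by
  rcases s with ⟨i, _ | _⟩
  · have hfl : B.label (i, false) = flip (B.lab i) := by
      rw [← B.label_true, ← B.label_flip]; rfl
    have hm := letterAct_strictMono B.gen_mono (flip (B.lab i))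
    have hx : letterAct B.gen (flip (B.lab i)) (B.x i) = B.x i := by
      rw [letterAct_flip, Equiv.Perm.inv_eq_iff_eq, B.act_x]
    have hd : letterAct B.gen (flip (B.lab i)) (B.d i) = B.m i := by
      rw [letterAct_flip, Equiv.Perm.inv_eq_iff_eq, B.act_m]
    rw [hfl]
    ext w
    obtain ⟨u, rfl⟩ := (letterAct B.gen (flip (B.lab i))).surjective w
    rw [(letterAct B.gen (flip (B.lab i))).injective.mem_set_image]
    change (_ ∧ ¬ (_ ∧ _)) ↔ _ < _ ∧ _ < _
    simp only [flip_fst]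
    rw [← hd, mem_Ioo]
    nth_rewrite 2 [← hx]
    rw [hm.lt_iff_lt, hm.lt_iff_lt]
    have := B.d_lt_y i
    grind
  · have hm := letterAct_strictMono B.gen_mono (B.lab i)
    rw [B.label_true]
    ext w
    obtain ⟨u, rfl⟩ := (letterAct B.gen (B.lab i)).surjective w
    rw [(letterAct B.gen (B.lab i)).injective.mem_set_image]
    change (_ ∧ ¬ (_ ∧ _)) ↔ _ ≤ _ ∧ _ < _
    simp only [flip_fst]
    rw [← B.act_m, mem_Ioo]
    nth_rewrite 2 [← B.act_y]
    rw [hm.lt_iff_lt, hm.le_iff_le]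
    have := B.x_lt_m i
    grind

/-- The ping-pong system of a family of bumps. -/
def toSystem [DenselyOrdered Ω] : FastSystem J ι Ω where
  gen := B.gen
  label := B.label
  label_flip := B.label_flip
  orb i := Ioo (B.x i) (B.y i)
  foot := B.foot
  foot_nonempty s := (nonempty_Ioo.2 (B.lo_lt_hi s)).mono (B.Ioo_subset_foot s)
  foot_disjoint _ _ _ := B.foot_disjoint
  foot_subset := B.foot_subset
  foot_subset_of_mem s _ _ hz hi :=
    Inside.foot_subset B (B.inside_of_mem (B.foot_subset_Ico s hz) hi)
  orb_disjoint := by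
    rintro ⟨i, b⟩ ⟨j, c⟩ h z hi hj
    simp only [label, Prod.mk.injEq] at h
    have hij : i = j := by
      by_contra hne
      rcases B.orb_le i j hne h.1 with h' | h'
      · exact absurd (hi.2.trans_le h') (not_lt.2 hj.1.le)
      · exact absurd (hj.2.trans_le h') (not_lt.2 hi.1.le)
    subst hij
    have := h.2
    revert this
    cases b <;> cases c <;> cases (B.lab i).2 <;> simp
  exists_mid i := ⟨B.m i, ⟨B.x_lt_m i, B.m_lt_y i⟩, by
    rintro (_ | _) h
    · exact lt_irrefl _ h.2
    · exact absurd (B.m_lt_d i) (not_lt.2 h.1)⟩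
  image_foot := B.image_foot
  fix := by
    rintro ⟨j, b⟩ z h
    have hj : B.gen j z = z := B.fix j z fun i hi => by
      refine h (i, b == (B.lab i).2) ?_
      simp only [label, Prod.mk.injEq, hi, true_and]
      cases b <;> cases (B.lab i).2 <;> rfl
    cases b
    · exact Equiv.Perm.inv_eq_iff_eq.2 hj.symm
    · exact hj

theorem inside_iff [DenselyOrdered Ω] (s : ι × Bool) (i : ι) :
    B.foot s ⊆ Ioo (B.x i) (B.y i) ↔ B.Inside s i := by
  refine ⟨fun h => ?_, fun h => Inside.foot_subset B h⟩
  obtain ⟨z, hz⟩ := nonempty_Ioo.2 (B.lo_lt_hi s)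
  exact B.inside_of_mem (Ioo_subset_Ico_self hz) (h (B.Ioo_subset_foot s hz))

/-- A bump is isolated when its support contains no feet but its own. -/
def Isolated (i : ι) : Prop := ∀ s, B.Inside s i → s.1 = i

/-- An orbital meeting the orbital of an isolated bump contains its closure. -/
theorem Isolated.lt {e c : ι} (he : B.Isolated e) (hne : c ≠ e) {z : Ω}
    (hz : z ∈ Ioo (B.x e) (B.y e)) (hc : z ∈ Ioo (B.x c) (B.y c)) :
    B.x c < B.x e ∧ B.y e < B.y c := by
  have key : ∀ b b', B.hi (c, b) ≤ B.lo (e, b') ∨ B.hi (e, b') ≤ B.lo (c, b) := fun b b' =>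
    B.hi_le_lo fun h => hne (congrArg Prod.fst h)
  have hin : ∀ b, ¬ (B.x e ≤ B.lo (c, b) ∧ B.hi (c, b) ≤ B.y e) := fun b h => hne (he (c, b) h)
  have h₁ := key false false
  have h₂ := key false true
  have h₃ := key true false
  have h₄ := key true true
  have h₅ := hin false
  have h₆ := hin true
  simp only [lo, hi, cond_true, cond_false] at h₁ h₂ h₃ h₄ h₅ h₆
  have := B.x_lt_m e
  have := B.m_lt_d e
  have := B.d_lt_y e
  have := B.x_lt_m c
  have := B.m_lt_d c
  have := B.d_lt_y c
  obtain ⟨hz₁, hz₂⟩ := hz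
  obtain ⟨hc₁, hc₂⟩ := hc
  grind

end

end BumpFamily

/-! ### Orbitals of monotone permutations -/

theorem perm_inv_monotone {Ω : Type*} [LinearOrder Ω] {f : Equiv.Perm Ω} (hf : Monotone f) :
    Monotone ⇑f⁻¹ :=
  (letterAct_strictMono (J := Unit) (g := fun _ => f) (fun _ => hf) ((), false)).monotone

theorem perm_strictMono {Ω : Type*} [LinearOrder Ω] {f : Equiv.Perm Ω}
    (hf : Monotone f) : StrictMono f := hf.strictMono_of_injective f.injective

section Orbital

variable {Ω : Type*} [CompleteLinearOrder Ω] {f : Equiv.Perm Ω}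

/-- Every point moved by a monotone permutation lies in an orbital with fixed ends. -/
theorem exists_orbital (hf : Monotone f) {t : Ω} (ht : f t ≠ t) :
    ∃ x y, t ∈ Ioo x y ∧ f x = x ∧ f y = y ∧ ∀ s ∈ Ioo x y, f s ≠ s := by
  have hsup : ∀ S : Set Ω, (∀ s ∈ S, f s = s) → f (sSup S) = sSup S := by
    intro S hS
    have key : ∀ g : Equiv.Perm Ω, Monotone g → (∀ s ∈ S, g s = s) → sSup S ≤ g (sSup S) :=
      fun g hg h => sSup_le fun s hs => (h s hs).symm.le.trans (hg (le_sSup hs))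
    refine le_antisymm ?_ (key f hf hS)
    have := hf (key f⁻¹ (perm_inv_monotone hf) fun s hs =>
      Equiv.Perm.inv_eq_iff_eq.2 (hS s hs).symm)
    simpa using this
  have hinf : ∀ S : Set Ω, (∀ s ∈ S, f s = s) → f (sInf S) = sInf S := by
    intro S hS
    have key : ∀ g : Equiv.Perm Ω, Monotone g → (∀ s ∈ S, g s = s) → g (sInf S) ≤ sInf S :=
      fun g hg h => le_sInf fun s hs => (hg (sInf_le hs)).trans (h s hs).le
    refine le_antisymm (key f hf hS) ?_
    have := hf (key f⁻¹ (perm_inv_monotone hf) fun s hs =>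
      Equiv.Perm.inv_eq_iff_eq.2 (hS s hs).symm)
    simpa using this
  have hx := hsup {s | s ≤ t ∧ f s = s} fun s hs => hs.2
  have hy := hinf {s | t ≤ s ∧ f s = s} fun s hs => hs.2
  refine ⟨_, _, ⟨lt_of_le_of_ne (sSup_le fun s hs => hs.1) ?_,
    lt_of_le_of_ne (le_sInf fun s hs => hs.1) ?_⟩, hx, hy, fun s hs hfs => ?_⟩
  · exact fun h => ht (h ▸ hx)
  · intro h
    rw [← h] at hy
    exact ht hy
  · rcases le_total s t with h | h
    · exact absurd (le_sSup (show s ∈ {s | s ≤ t ∧ f s = s} from ⟨h, hfs⟩)) (not_le.2 hs.1)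
    · exact absurd (sInf_le (show s ∈ {s | t ≤ s ∧ f s = s} from ⟨h, hfs⟩)) (not_le.2 hs.2)

theorem exists_fixed_of_lt (hf : Monotone f) {s t : Ω} (hst : s ≤ t) (hs : s ≤ f s)
    (ht : f t ≤ t) : ∃ w ∈ Icc s t, f w = w := by
  set S := {r | r ∈ Icc s t ∧ r ≤ f r}
  have hsS : s ∈ S := ⟨⟨le_rfl, hst⟩, hs⟩
  have h₁ : sSup S ≤ f (sSup S) := sSup_le fun r hr => hr.2.trans (hf (le_sSup hr))
  have h₂ : sSup S ≤ t := sSup_le fun r hr => hr.1.2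
  have h₃ : s ≤ sSup S := le_sSup hsS
  exact ⟨_, ⟨h₃, h₂⟩, le_antisymm (le_sSup ⟨⟨h₃.trans h₁, (hf h₂).trans ht⟩, hf h₁⟩) h₁⟩

/-- A monotone permutation moves the points of an orbital in one direction. -/
theorem lt_apply_of_orbital (hf : Monotone f) {x y : Ω} (h : ∀ s ∈ Ioo x y, f s ≠ s) {s t : Ω}
    (hs : s ∈ Ioo x y) (ht : t ∈ Ioo x y) (hlt : s < f s) : t < f t := by
  by_contra! hle
  rcases le_total s t with hst | hst
  · obtain ⟨w, hw, hfw⟩ := exists_fixed_of_lt hf hst hlt.le hle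
    exact h w ⟨hs.1.trans_le hw.1, hw.2.trans_lt ht.2⟩ hfw
  · obtain ⟨w, hw, hfw⟩ := exists_fixed_of_lt (f := f⁻¹) (perm_inv_monotone hf) hst
      (by simpa using (perm_inv_monotone hf) hle) (by simpa using (perm_inv_monotone hf) hlt.le)
    exact h w ⟨ht.1.trans_le hw.1, hw.2.trans_lt hs.2⟩ (Equiv.Perm.inv_eq_iff_eq.1 hfw).symm

end Orbital

/-- Monotone permutations agreeing on an interval whose ends one of them fixes fix its ends. -/
theorem apply_ends_eq_of_eqOn {Ω : Type*} [LinearOrder Ω] [DenselyOrdered Ω]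
    {g h : Equiv.Perm Ω} (hg : Monotone g) (hh : Monotone h) {x y : Ω} (hxy : x < y)
    (hx : h x = x) (hy : h y = y) (he : EqOn g h (Ioo x y)) : g x = x ∧ g y = y := by
  have hg' := (perm_strictMono hg)
  have hh' := (perm_strictMono hh)
  have hpre : ∀ w ∈ Ioo x y, ∃ z ∈ Ioo x y, g z = w := by
    intro w hw
    obtain ⟨z, rfl⟩ := h.surjective w
    have hz : z ∈ Ioo x y := by
      constructor
      · exact hh'.lt_iff_lt.1 (hx.trans_lt hw.1)
      · exact hh'.lt_iff_lt.1 (hw.2.trans_eq hy.symm)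
    exact ⟨z, hz, he hz⟩
  have himg : ∀ z ∈ Ioo x y, g z ∈ Ioo x y := by
    intro z hz
    rw [he hz]
    exact ⟨hx.symm.trans_lt (hh' hz.1), (hh' hz.2).trans_eq hy⟩
  constructor
  · refine le_antisymm (le_of_not_gt fun hlt => ?_) (le_of_not_gt fun hlt => ?_)
    · obtain ⟨w, hw₁, hw₂⟩ := exists_between (lt_min hlt hxy)
      obtain ⟨z, hz, rfl⟩ := hpre w ⟨hw₁, hw₂.trans_le (min_le_right _ _)⟩
      exact absurd (hg' hz.1) (not_lt.2 (hw₂.le.trans (min_le_left _ _)))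
    · obtain ⟨v, rfl⟩ := g.surjective x
      have hv := hg'.lt_iff_lt.1 hlt
      obtain ⟨w, hw₁, hw₂⟩ := exists_between (lt_min hv hxy)
      have := himg w ⟨hw₁, hw₂.trans_le (min_le_right _ _)⟩
      exact absurd this.1 (not_lt.2 (hg (hw₂.le.trans (min_le_left _ _))))
  · refine le_antisymm (le_of_not_gt fun hlt => ?_) (le_of_not_gt fun hlt => ?_)
    · obtain ⟨v, rfl⟩ := g.surjective y
      have hv := hg'.lt_iff_lt.1 hlt
      obtain ⟨w, hw₁, hw₂⟩ := exists_between (max_lt hv hxy)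
      have := himg w ⟨(le_max_right _ _).trans_lt hw₁, hw₂⟩
      exact absurd this.2 (not_lt.2 (hg ((le_max_left _ _).trans hw₁.le)))
    · obtain ⟨w, hw₁, hw₂⟩ := exists_between (max_lt hlt hxy)
      obtain ⟨z, hz, rfl⟩ := hpre w ⟨(le_max_right _ _).trans_lt hw₁, hw₂⟩
      exact absurd (hg' hz.2) (not_lt.2 ((le_max_left _ _).trans hw₁.le))

theorem isLeftTransition_of_Ioo {f : Homeo01} {x y : UI} (hxy : x < y) (hx : f x = x)
    (h : Ioo x y ⊆ supt f) : IsLeftTransition f x := by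
  refine ⟨fun hs => hs hx, fun ε hε => ?_⟩
  have hlt : (x : ℝ) < min (y : ℝ) (x + ε) := lt_min hxy (by linarith)
  obtain ⟨r, hr₁, hr₂⟩ := exists_between hlt
  have hry := hr₂.trans_le (min_le_left _ _)
  exact ⟨⟨r, x.2.1.trans hr₁.le, hry.le.trans y.2.2⟩, h ⟨hr₁, hry⟩, hr₁,
    hr₂.trans_le (min_le_right _ _)⟩

/-- The support of a positive bump is an interval. -/
theorem IsPosBump.exists_supt_eq {a : Homeo01} (ha : IsPosBump a) :
    ∃ x y, x < y ∧ a x = x ∧ a y = y ∧ supt a = Ioo x y := by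
  obtain ⟨t, ht⟩ := ha.1.2.nonempty
  obtain ⟨x, y, hxy, hx, hy, h⟩ := exists_orbital ha.1.1 ht
  refine ⟨x, y, hxy.1.trans hxy.2, hx, hy, Subset.antisymm (fun z hz => ?_) h⟩
  have hc := ha.1.2.isPreconnected.ordConnected
  constructor
  · by_contra! hzx
    exact hc.out hz ht ⟨hzx, hxy.1.le⟩ hx
  · by_contra! hzy
    exact hc.out ht hz ⟨hxy.2.le, hzy⟩ hy

theorem exists_lab {X : Set Homeo01} (hX : ∀ f ∈ X, IsOPH f) (a : usedBumps X) :
    ∃ (l : X × Bool) (x y : UI), x < y ∧ supt a.1 = Ioo x y ∧ a.1 x = x ∧ a.1 y = y ∧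
      EqOn (letterAct (fun j : X => j.1) l) a.1 (Ioo x y) ∧
      letterAct (fun j : X => j.1) l x = x ∧ letterAct (fun j : X => j.1) l y = y := by
  obtain ⟨f, hf, ha, h⟩ := a.2
  obtain ⟨x, y, hxy, hx, hy, hs⟩ := ha.exists_supt_eq
  obtain ⟨l, hl⟩ : ∃ l : X × Bool, EqOn (letterAct (fun j : X => j.1) l) a.1 (Ioo x y) := by
    rw [hs] at h
    rcases h with h | h
    · exact ⟨(⟨f, hf⟩, true), h⟩
    · refine ⟨(⟨f, hf⟩, false), fun z hz => ?_⟩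
      have haz : a.1 z ∈ Ioo x y :=
        ⟨hx.symm.trans_lt (perm_strictMono ha.1.1 hz.1),
          (perm_strictMono ha.1.1 hz.2).trans_eq hy⟩
      refine Equiv.Perm.inv_eq_iff_eq.2 ?_
      rw [h haz]
      simp
  have he := apply_ends_eq_of_eqOn
    (letterAct_strictMono (g := fun j : X => j.1) (fun j => hX _ j.2) l).monotone ha.1.1 hxy hx hy
    hl
  exact ⟨l, x, y, hxy, hs, hx, hy, hl, he⟩

theorem letterAct_apply_eq_iff {J Ω : Type*} (g : J → Equiv.Perm Ω) (l : J × Bool) (z : Ω) :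
    letterAct g l z = z ↔ g l.1 z = z := by
  rcases l with ⟨j, _ | _⟩
  · exact Equiv.Perm.inv_eq_iff_eq.trans eq_comm
  · exact Iff.rfl

open Classical in
/-- Every point moved by a monotone permutation lies in the support of a bump used in it. -/
theorem exists_usedIn {f : Homeo01} (hf : IsOPH f) {t : UI} (ht : f t ≠ t) :
    ∃ a, UsedIn f a ∧ t ∈ supt a := by
  have key : ∀ g : Homeo01, IsOPH g → t < g t →
      ∃ a, IsPosBump a ∧ EqOn g a (supt a) ∧ t ∈ supt a := by
    intro g hg htg
    obtain ⟨x, y, hxy, hx, hy, h⟩ := exists_orbital hg htg.ne'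
    have hg' := perm_strictMono hg
    have hmem : ∀ z, g z ∈ Ioo x y ↔ z ∈ Ioo x y := by
      intro z
      conv_lhs => rw [← hx, ← hy]
      simp only [mem_Ioo, hg'.lt_iff_lt]
    set a : Homeo01 := Equiv.Perm.ofSubtype (g.subtypePerm hmem) with ha
    have ha₁ : ∀ z ∈ Ioo x y, a z = g z := fun z hz => by
      rw [ha, Equiv.Perm.ofSubtype_apply_of_mem _ hz]
      rfl
    have ha₂ : ∀ z, z ∉ Ioo x y → a z = z := fun z hz =>
      Equiv.Perm.ofSubtype_apply_of_not_mem _ hz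
    have hsa : supt a = Ioo x y := by
      ext z
      by_cases hz : z ∈ Ioo x y
      · simp only [supt, mem_ofPred_eq, ha₁ z hz, hz, iff_true]
        exact h z hz
      · simp only [supt, mem_ofPred_eq, ha₂ z hz, hz, ne_eq, not_true_eq_false]
    refine ⟨a, ⟨⟨fun u v huv => ?_, ?_⟩, ?_⟩, ?_, hsa ▸ hxy⟩
    · by_cases hu : u ∈ Ioo x y <;> by_cases hv : v ∈ Ioo x y
      · rw [ha₁ u hu, ha₁ v hv]
        exact hg huv
      · rw [ha₁ u hu, ha₂ v hv]
        have := (hmem u).2 hu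
        simp only [mem_Ioo, not_and, not_lt] at this hu hv ⊢
        exact this.2.le.trans (hv (hu.1.trans_le huv))
      · rw [ha₂ u hu, ha₁ v hv]
        have := (hmem v).2 hv
        simp only [mem_Ioo, not_and, not_lt] at this hu hv ⊢
        by_cases hxu : x < u
        · exact absurd (huv.trans_lt hv.2) (not_lt.2 (hu hxu))
        · exact (not_lt.1 hxu).trans this.1.le
      · rw [ha₂ u hu, ha₂ v hv]
        exact huv
    · rw [hsa]
      exact isConnected_Ioo (hxy.1.trans hxy.2)
    · intro z hz
      rw [hsa] at hz
      rw [ha₁ z hz]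
      exact lt_apply_of_orbital hg h hxy hz htg
    · rw [hsa]
      exact fun z hz => (ha₁ z hz).symm
  rcases lt_or_gt_of_ne ht with h | h
  · obtain ⟨a, h₁, h₂, h₃⟩ := key f⁻¹ (perm_inv_monotone hf)
      (by simpa using perm_strictMono (perm_inv_monotone hf) h)
    refine ⟨a, ⟨h₁, Or.inr fun z hz => ?_⟩, h₃⟩
    have hz' : a⁻¹ z ∈ supt a := by
      intro he
      rw [show a (a⁻¹ z) = z from a.apply_symm_apply z] at he
      exact hz (Equiv.Perm.inv_eq_iff_eq.1 he.symm).symm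
    have := h₂ hz'
    rw [show a (a⁻¹ z) = z from a.apply_symm_apply z, Equiv.Perm.inv_eq_iff_eq] at this
    exact this.symm
  · obtain ⟨a, h₁, h₂, h₃⟩ := key f hf h
    exact ⟨a, ⟨h₁, Or.inl h₂⟩, h₃⟩

/-- The bumps used in a geometrically fast set form a family of bumps. -/
theorem exists_bumpFamily {X : Set Homeo01} (hX : ∀ f ∈ X, IsOPH f) (hfast : GeomFast X) :
    ∃ B : BumpFamily X (usedBumps X) UI, (∀ j, B.gen j = j.1) ∧
      ∀ i, Ioo (B.x i) (B.y i) ⊆ supt (B.gen (B.lab i).1) := by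
  obtain ⟨hprop, hpos, m, hm, hfeet⟩ := hfast
  choose lab x y hxy hs hx hy hl hlx hly using exists_lab hX
  have hpos' : ∀ a : usedBumps X, StrictMono a.1 := fun a =>
    perm_strictMono (hpos a.1 a.2).1.1
  have hm' : ∀ a : usedBumps X, m a.1 ∈ Ioo (x a) (y a) := fun a => hs a ▸ hm a.1 a.2
  have hsub : ∀ a : usedBumps X, Ioo (x a) (y a) ⊆ supt ((lab a).1 : Homeo01) := by
    intro a z hz hfix
    have := (letterAct_apply_eq_iff (fun j : X => j.1) (lab a) z).2 hfix
    rw [hl a hz] at this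
    rw [← hs a] at hz
    exact hz this
  have hfoot : ∀ s : usedBumps X × Bool,
      Ioo (cond s.2 (s.1.1 (m s.1.1)) (x s.1)) (cond s.2 (y s.1) (m s.1.1)) ⊆
        foot s.1.1 (m s.1.1) s.2 := by
    rintro ⟨a, _ | _⟩ z ⟨hz₁, hz₂⟩
    · refine ⟨?_, hz₂⟩
      rw [hs a]
      exact ⟨hz₁, hz₂.trans (hm' a).2⟩
    · refine ⟨?_, hz₁.le⟩
      rw [hs a]
      refine ⟨?_, hz₂⟩
      refine lt_trans ?_ hz₁
      exact (hx a).symm.trans_lt (hpos' a (hm' a).1)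
  have hfeet' : ∀ s t : usedBumps X × Bool, s ≠ t →
      Disjoint (foot s.1.1 (m s.1.1) s.2) (foot t.1.1 (m t.1.1) t.2) := by
    intro s t hst
    refine hfeet _ s.1.2 _ t.1.2 _ _ fun h => hst ?_
    rw [Prod.mk.injEq] at h
    exact Prod.ext (Subtype.ext h.1) h.2
  have hfix : ∀ a : usedBumps X, ((lab a).1 : Homeo01) (x a) = x a ∧
      ((lab a).1 : Homeo01) (y a) = y a := fun a =>
    ⟨(letterAct_apply_eq_iff (fun j : X => j.1) (lab a) _).1 (hlx a),
      (letterAct_apply_eq_iff (fun j : X => j.1) (lab a) _).1 (hly a)⟩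
  have hunique : ∀ (f : X) (a : usedBumps X), UsedIn f.1 a.1 → (lab a).1 = f := by
    intro f a hfa
    by_contra hne
    have hsubf : Ioo (x a) (y a) ⊆ supt f.1 := by
      intro z hz
      rw [← hs a] at hz
      rcases hfa.2 with h | h
      · intro he
        exact hz ((h hz).symm.trans he)
      · intro he
        exact hz (Equiv.Perm.inv_eq_iff_eq.1 ((h hz).symm.trans he)).symm
    have hfx : f.1 (x a) = x a := by
      have ha := (hpos a.1 a.2).1.1
      have h' := hfa.2
      rw [hs a] at h'
      rcases h' with h | h
      · exact (apply_ends_eq_of_eqOn (hX _ f.2) ha (hxy a) (hx a) (hy a) h).1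
      · exact (apply_ends_eq_of_eqOn (hX _ f.2) (perm_inv_monotone ha) (hxy a)
          (Equiv.Perm.inv_eq_iff_eq.2 (hx a).symm) (Equiv.Perm.inv_eq_iff_eq.2 (hy a).symm) h).1
    exact hprop.1 _ (lab a).1.2 _ f.2 (fun h => hne (Subtype.ext h)) (x a)
      ⟨isLeftTransition_of_Ioo (hxy a) (hfix a).1 (hsub a),
        isLeftTransition_of_Ioo (hxy a) hfx hsubf⟩
  refine ⟨{
    gen := fun j => j.1
    gen_mono := fun j => hX _ j.2
    lab := lab
    x := x
    m := fun a => m a.1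
    d := fun a => a.1 (m a.1)
    y := y
    x_lt_m := fun a => (hm' a).1
    m_lt_d := fun a => (hpos a.1 a.2).2 _ (hm a.1 a.2)
    d_lt_y := fun a => (hpos' a (hm' a).2).trans_eq (hy a)
    foot_le := fun s t hst => ?_
    orb_le := fun a b hab hlab => ?_
    act_x := hlx
    act_m := fun a => hl a (hm' a)
    act_y := hly
    fix := fun j z hz => ?_ }, fun j => rfl, hsub⟩
  · by_contra! hcon
    have key : ∀ s : usedBumps X × Bool,
        cond s.2 (s.1.1 (m s.1.1)) (x s.1) < cond s.2 (y s.1) (m s.1.1) := by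
      rintro ⟨a, _ | _⟩
      · exact (hm' a).1
      · exact (hpos' a (hm' a).2).trans_eq (hy a)
    obtain ⟨w, hw₁, hw₂⟩ := exists_between (max_lt (lt_min (key s) hcon.2) (lt_min hcon.1 (key t)))
    rw [max_lt_iff] at hw₁
    rw [lt_min_iff] at hw₂
    exact disjoint_left.1 (hfeet' s t hst) (hfoot s ⟨hw₁.1, hw₂.1⟩) (hfoot t ⟨hw₁.2, hw₂.2⟩)
  · have key : ∀ a b : usedBumps X, (lab a).1 = (lab b).1 → x a < x b → y a ≤ x b := by
      intro a b h hlt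
      by_contra! hlt'
      exact hsub a ⟨hlt, hlt'⟩ (h ▸ (hfix b).1)
    rcases lt_trichotomy (x a) (x b) with h | h | h
    · exact Or.inl (key a b hlab h)
    · exfalso
      obtain ⟨w, hw₁, hw₂⟩ := exists_between (lt_min (hm' a).1 (h ▸ (hm' b).1))
      rw [lt_min_iff] at hw₂
      exact disjoint_left.1 (hfeet' (a, false) (b, false) fun h => hab (congrArg Prod.fst h))
        (hfoot (a, false) ⟨hw₁, hw₂.1⟩) (hfoot (b, false) ⟨h ▸ hw₁, hw₂.2⟩)
    · exact Or.inr (key b a hlab.symm h)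
  · by_contra hne
    obtain ⟨a, ha, hza⟩ := exists_usedIn (hX _ j.2) hne
    have haX : a ∈ usedBumps X := ⟨j.1, j.2, ha⟩
    refine hz ⟨a, haX⟩ (hunique j ⟨a, haX⟩ ha) ?_
    rw [← hs]
    exact hza

/-! ### Finiteness of the set of non-isolated bumps -/

open Filter Topology in
/-- An accumulation point of points of the support of `f` that pairwise lie in different orbitals
is a transition point of `f`. -/
theorem isLeftTransition_of_frequently {f : Homeo01} {Q : Set UI} (hQ : Q ⊆ supt f)
    (hf : ∀ z ∈ supt f, ∃ x y, z ∈ Ioo x y ∧ (Q ∩ Ioo x y).Subsingleton) {t : UI}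
    (ht : ∃ᶠ q in 𝓝[>] t, q ∈ Q) : IsLeftTransition f t := by
  have key : ∀ u, t < u → ∃ q ∈ Q, q ∈ Ioo t u := fun u hu =>
    (ht.and_eventually (Ioo_mem_nhdsGT hu)).exists
  constructor
  · intro hs
    obtain ⟨x, y, hz, hsub⟩ := hf t hs
    obtain ⟨q, hq, hq'⟩ := key y hz.2
    obtain ⟨r, hr, hr'⟩ := key q hq'.1
    have := hsub ⟨hr, hz.1.trans hr'.1, hr'.2.trans hq'.2⟩ ⟨hq, hz.1.trans hq'.1, hq'.2⟩
    exact hr'.2.ne this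
  · intro ε hε
    have hev : ∀ᶠ s : UI in 𝓝[>] t, (s : ℝ) < t + ε :=
      (continuous_subtype_val.continuousAt.eventually_lt continuousAt_const
        (by linarith)).filter_mono nhdsWithin_le_nhds
    obtain ⟨q, ⟨hq, hq'⟩, hq''⟩ := ((ht.and_eventually hev).and_eventually
      self_mem_nhdsWithin).exists
    exact ⟨q, hQ hq, hq'', hq'⟩

open Filter Topology in
theorem isRightTransition_of_frequently {f : Homeo01} {Q : Set UI} (hQ : Q ⊆ supt f)
    (hf : ∀ z ∈ supt f, ∃ x y, z ∈ Ioo x y ∧ (Q ∩ Ioo x y).Subsingleton) {t : UI}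
    (ht : ∃ᶠ q in 𝓝[<] t, q ∈ Q) : IsRightTransition f t := by
  have key : ∀ u, u < t → ∃ q ∈ Q, q ∈ Ioo u t := fun u hu =>
    (ht.and_eventually (Ioo_mem_nhdsLT hu)).exists
  constructor
  · intro hs
    obtain ⟨x, y, hz, hsub⟩ := hf t hs
    obtain ⟨q, hq, hq'⟩ := key x hz.1
    obtain ⟨r, hr, hr'⟩ := key q hq'.2
    have := hsub ⟨hr, hq'.1.trans hr'.1, hr'.2.trans hz.2⟩ ⟨hq, hq'.1, hq'.2.trans hz.2⟩
    exact hr'.1.ne' this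
  · intro ε hε
    have hev : ∀ᶠ s : UI in 𝓝[<] t, (t : ℝ) - ε < s :=
      (continuousAt_const.eventually_lt continuous_subtype_val.continuousAt
        (by linarith)).filter_mono nhdsWithin_le_nhds
    obtain ⟨q, ⟨hq, hq'⟩, hq''⟩ := ((ht.and_eventually hev).and_eventually
      self_mem_nhdsWithin).exists
    exact ⟨q, hQ hq, hq'', hq'⟩

open Filter Topology in
theorem exists_transition_of_infinite {f g : Homeo01} {Q : Set UI} (hQ : Q.Infinite)
    (hf : Q ⊆ supt f) (hg : Q ⊆ supt g)
    (hf' : ∀ z ∈ supt f, ∃ x y, z ∈ Ioo x y ∧ (Q ∩ Ioo x y).Subsingleton)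
    (hg' : ∀ z ∈ supt g, ∃ x y, z ∈ Ioo x y ∧ (Q ∩ Ioo x y).Subsingleton) :
    ∃ t, (IsLeftTransition f t ∧ IsLeftTransition g t) ∨
      (IsRightTransition f t ∧ IsRightTransition g t) := by
  obtain ⟨t, ht⟩ := hQ.exists_accPt_principal
  rw [accPt_iff_frequently_nhdsNE, ← Iio_union_Ioi, nhdsWithin_union, frequently_sup] at ht
  rcases ht with h | h
  · exact ⟨t, Or.inr ⟨isRightTransition_of_frequently hf hf' h,
      isRightTransition_of_frequently hg hg' h⟩⟩
  · exact ⟨t, Or.inl ⟨isLeftTransition_of_frequently hf hf' h,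
      isLeftTransition_of_frequently hg hg' h⟩⟩

namespace BumpFamily

theorem eq_of_mem {J ι Ω : Type*} [LinearOrder Ω] (B : BumpFamily J ι Ω) {i j : ι}
    (h : (B.lab i).1 = (B.lab j).1) {z : Ω} (hi : z ∈ Ioo (B.x i) (B.y i))
    (hj : z ∈ Ioo (B.x j) (B.y j)) : i = j := by
  by_contra hne
  rcases B.orb_le i j hne h with h' | h'
  · exact absurd (hi.2.trans_le h') (not_lt.2 hj.1.le)
  · exact absurd (hj.2.trans_le h') (not_lt.2 hi.1.le)

/-- In a geometrically proper finite family all but finitely many bumps are isolated. -/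
theorem finite_not_isolated {J ι : Type*} [Finite J] (B : BumpFamily J ι UI)
    (hsupt : ∀ i, Ioo (B.x i) (B.y i) ⊆ supt (B.gen (B.lab i).1))
    (hprop : ∀ j k, j ≠ k → ∀ t, ¬ ((IsLeftTransition (B.gen j) t ∧ IsLeftTransition (B.gen k) t) ∨
      (IsRightTransition (B.gen j) t ∧ IsRightTransition (B.gen k) t))) :
    {c | ¬ B.Isolated c}.Finite := by
  set N : J × J × Bool → Set ι := fun p =>
    {c | (B.lab c).1 = p.1 ∧ ∃ a, a ≠ c ∧ (B.lab a).1 = p.2.1 ∧ B.Inside (a, p.2.2) c} with hN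
  have hcover : {c | ¬ B.Isolated c} ⊆ ⋃ p, N p := by
    intro c hc
    obtain ⟨s, hs, hne⟩ : ∃ s, B.Inside s c ∧ s.1 ≠ c := by
      simp only [mem_ofPred_eq, Isolated] at hc
      push Not at hc
      exact hc
    exact mem_iUnion.2 ⟨((B.lab c).1, (B.lab s.1).1, s.2), rfl, s.1, hne, rfl, hs⟩
  refine (finite_iUnion fun p => ?_).subset hcover
  obtain ⟨j, k, b⟩ := p
  by_contra hinf
  have hex : ∀ c ∈ N (j, k, b), ∃ q, ∃ a, a ≠ c ∧ (B.lab a).1 = k ∧ q ∈ B.foot (a, b) ∧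
      B.foot (a, b) ⊆ Ioo (B.x c) (B.y c) := by
    rintro c ⟨-, a, ha, hk, hin⟩
    obtain ⟨q, hq⟩ := nonempty_Ioo.2 (B.lo_lt_hi (a, b))
    exact ⟨q, a, ha, hk, B.Ioo_subset_foot _ hq, Inside.foot_subset B hin⟩
  choose! q a ha hk hq hsub using hex
  have hj : ∀ c ∈ N (j, k, b), (B.lab c).1 = j := fun c hc => hc.1
  have hqa : ∀ c ∈ N (j, k, b), q c ∈ Ioo (B.x (a c)) (B.y (a c)) := fun c hc =>
    B.foot_subset (a c, b) (hq c hc)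
  have hqc : ∀ c ∈ N (j, k, b), q c ∈ Ioo (B.x c) (B.y c) := fun c hc => hsub c hc (hq c hc)
  have hinj : InjOn q (N (j, k, b)) := fun c hc c' hc' h =>
    B.eq_of_mem ((hj c hc).trans (hj c' hc').symm) (hqc c hc) (h ▸ hqc c' hc')
  have hjk : j ≠ k := by
    rintro rfl
    obtain ⟨c, hc⟩ := Set.Infinite.nonempty hinf
    exact ha c hc (B.eq_of_mem ((hk c hc).trans (hj c hc).symm) (hqa c hc) (hqc c hc))
  have hQj : ∀ z ∈ supt (B.gen j), ∃ x y, z ∈ Ioo x y ∧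
      (q '' N (j, k, b) ∩ Ioo x y).Subsingleton := by
    intro z hz
    obtain ⟨i, hi, hzi⟩ : ∃ i, (B.lab i).1 = j ∧ z ∈ Ioo (B.x i) (B.y i) := by
      by_contra! h
      exact hz (B.fix j z h)
    refine ⟨_, _, hzi, ?_⟩
    rintro _ ⟨⟨c, hc, rfl⟩, h⟩ _ ⟨⟨c', hc', rfl⟩, h'⟩
    rw [B.eq_of_mem ((hj c hc).trans hi.symm) (hqc c hc) h,
      B.eq_of_mem ((hj c' hc').trans hi.symm) (hqc c' hc') h']
  have hQk : ∀ z ∈ supt (B.gen k), ∃ x y, z ∈ Ioo x y ∧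
      (q '' N (j, k, b) ∩ Ioo x y).Subsingleton := by
    intro z hz
    obtain ⟨i, hi, hzi⟩ : ∃ i, (B.lab i).1 = k ∧ z ∈ Ioo (B.x i) (B.y i) := by
      by_contra! h
      exact hz (B.fix k z h)
    refine ⟨_, _, hzi, ?_⟩
    rintro _ ⟨⟨c, hc, rfl⟩, h⟩ _ ⟨⟨c', hc', rfl⟩, h'⟩
    have hc₁ := B.eq_of_mem ((hk c hc).trans hi.symm) (hqa c hc) h
    have hc₂ := B.eq_of_mem ((hk c' hc').trans hi.symm) (hqa c' hc') h'
    have : q c ∈ Ioo (B.x c') (B.y c') := by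
      refine hsub c' hc' ?_
      rw [hc₂, ← hc₁]
      exact hq c hc
    rw [B.eq_of_mem ((hj c hc).trans (hj c' hc').symm) (hqc c hc) this]
  obtain ⟨t, ht⟩ := exists_transition_of_infinite (Set.Infinite.image hinj hinf)
    (image_subset_iff.2 fun c hc => hj c hc ▸ hsupt c (hqc c hc))
    (image_subset_iff.2 fun c hc => hk c hc ▸ hsupt (a c) (hqa c hc)) hQj hQk
  exact hprop j k hjk t ht

end BumpFamily

/-! ### Dyadic piecewise linear permutations of the line -/

namespace IsDyadic

theorem add {x y : ℝ} (hx : IsDyadic x) (hy : IsDyadic y) : IsDyadic (x + y) := by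
  obtain ⟨a, k, rfl⟩ := hx
  obtain ⟨b, l, rfl⟩ := hy
  refine ⟨a * 2 ^ l + b * 2 ^ k, k + l, ?_⟩
  push_cast
  rw [pow_add]
  field_simp

theorem mul {x y : ℝ} (hx : IsDyadic x) (hy : IsDyadic y) : IsDyadic (x * y) := by
  obtain ⟨a, k, rfl⟩ := hx
  obtain ⟨b, l, rfl⟩ := hy
  refine ⟨a * b, k + l, ?_⟩
  push_cast
  rw [pow_add]
  field_simp

theorem neg {x : ℝ} (hx : IsDyadic x) : IsDyadic (-x) := by
  obtain ⟨a, k, rfl⟩ := hx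
  exact ⟨-a, k, by push_cast; ring⟩

theorem sub {x y : ℝ} (hx : IsDyadic x) (hy : IsDyadic y) : IsDyadic (x - y) := by
  rw [sub_eq_add_neg]
  exact hx.add hy.neg

theorem zpow (k : ℤ) : IsDyadic ((2 : ℝ) ^ k) := by
  obtain ⟨n, rfl | rfl⟩ := k.eq_nat_or_neg
  · exact ⟨2 ^ n, 0, by simp⟩
  · exact ⟨1, n, by simp⟩

theorem zero : IsDyadic 0 := ⟨0, 0, by simp⟩

theorem one : IsDyadic 1 := ⟨1, 0, by simp⟩

end IsDyadic

/-- Monotone permutations of the line that are piecewise linear with finitely many breakpoints,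
dyadic breakpoints and translation parts, and powers of two as slopes. -/
def DyadicPL (f : Equiv.Perm ℝ) : Prop :=
  Monotone f ∧ ∃ P : Finset ℝ, (∀ p ∈ P, IsDyadic p) ∧
    ∀ s t, s ≤ t → (∀ p ∈ P, ¬ (s < p ∧ p < t)) →
      ∃ (k : ℤ) (d : ℝ), IsDyadic d ∧ ∀ r ∈ Icc s t, f r = 2 ^ k * r + d

namespace DyadicPL

theorem isDyadic_inv {f : Equiv.Perm ℝ} (hf : DyadicPL f) {x : ℝ} (hx : IsDyadic x) :
    IsDyadic (f⁻¹ x) := by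
  obtain ⟨y, rfl⟩ := f.surjective x
  obtain ⟨P, -, h⟩ := hf.2
  obtain ⟨k, d, hd, h⟩ := h y y le_rfl fun p _ hp => absurd (hp.1.trans hp.2) (lt_irrefl _)
  have hy := h y ⟨le_rfl, le_rfl⟩
  have h2 : (2 : ℝ) ^ k ≠ 0 := by positivity
  have : f⁻¹ (f y) = 2 ^ (-k) * (f y - d) := by
    rw [show f⁻¹ (f y) = y from f.symm_apply_apply y, hy, zpow_neg]
    field_simp
    ring
  rw [this]
  exact (IsDyadic.zpow _).mul (hx.sub hd)

theorem isDyadic_apply {f : Equiv.Perm ℝ} (hf : DyadicPL f) {x : ℝ} (hx : IsDyadic x) :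
    IsDyadic (f x) := by
  obtain ⟨P, -, h⟩ := hf.2
  obtain ⟨k, d, hd, h⟩ := h x x le_rfl fun p _ hp => absurd (hp.1.trans hp.2) (lt_irrefl _)
  rw [h x ⟨le_rfl, le_rfl⟩]
  exact ((IsDyadic.zpow _).mul hx).add hd

theorem mul {f g : Equiv.Perm ℝ} (hf : DyadicPL f) (hg : DyadicPL g) : DyadicPL (f * g) := by
  have hg' := perm_strictMono hg.1
  obtain ⟨P, hP, hfP⟩ := hf.2
  obtain ⟨Q, hQ, hgQ⟩ := hg.2
  refine ⟨hf.1.comp hg.1, Q ∪ P.image ⇑g⁻¹, fun p hp => ?_, fun s t hst h => ?_⟩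
  · rw [Finset.mem_union, Finset.mem_image] at hp
    rcases hp with hp | ⟨p, hp, rfl⟩
    · exact hQ p hp
    · exact isDyadic_inv hg (hP p hp)
  · obtain ⟨k, d, hd, hk⟩ := hgQ s t hst fun p hp => h p (Finset.mem_union_left _ hp)
    obtain ⟨l, e, he, hl⟩ := hfP (g s) (g t) (hg.1 hst) fun p hp hlt => by
      obtain ⟨r, rfl⟩ := g.surjective p
      refine h r (Finset.mem_union_right _ (Finset.mem_image.2 ⟨_, hp, by simp⟩)) ?_
      rwa [hg'.lt_iff_lt, hg'.lt_iff_lt] at hlt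
    refine ⟨l + k, 2 ^ l * d + e, ((IsDyadic.zpow _).mul hd).add he, fun r hr => ?_⟩
    rw [Equiv.Perm.mul_apply, hl _ ⟨hg.1 hr.1, hg.1 hr.2⟩, hk r hr, zpow_add₀ (by norm_num)]
    ring

theorem inv {f : Equiv.Perm ℝ} (hf : DyadicPL f) : DyadicPL f⁻¹ := by
  have hf' := perm_strictMono hf.1
  obtain ⟨P, hP, hfP⟩ := hf.2
  refine ⟨perm_inv_monotone hf.1, P.image f, fun p hp => ?_, fun s t hst h => ?_⟩
  · obtain ⟨q, hq, rfl⟩ := Finset.mem_image.1 hp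
    exact isDyadic_apply hf (hP q hq)
  · obtain ⟨s, rfl⟩ := f.surjective s
    obtain ⟨t, rfl⟩ := f.surjective t
    obtain ⟨k, d, hd, hk⟩ := hfP s t (hf'.le_iff_le.1 hst) fun p hp hlt =>
      h (f p) (Finset.mem_image_of_mem _ hp) ⟨hf' hlt.1, hf' hlt.2⟩
    refine ⟨-k, -(2 ^ (-k) * d), ((IsDyadic.zpow _).mul hd).neg, fun r hr => ?_⟩
    obtain ⟨r, rfl⟩ := f.surjective r
    have h2 : (2 : ℝ) ^ k ≠ 0 := by positivity
    rw [show f⁻¹ (f r) = r from f.symm_apply_apply r,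
      hk r ⟨hf'.le_iff_le.1 hr.1, hf'.le_iff_le.1 hr.2⟩, zpow_neg]
    field_simp
    ring

theorem one : DyadicPL 1 :=
  ⟨fun _ _ h => h, ∅, by simp, fun s t _ _ => ⟨0, 0, IsDyadic.zero, fun r _ => by simp⟩⟩

/-- An affine map. -/
theorem exists_affine (k : ℤ) {d : ℝ} (hd : IsDyadic d) :
    ∃ f : Equiv.Perm ℝ, DyadicPL f ∧ ∀ r, f r = 2 ^ k * r + d := by
  have h2 : (0 : ℝ) < 2 ^ k := by positivity
  refine ⟨⟨fun r => 2 ^ k * r + d, fun r => (r - d) / 2 ^ k, fun r => ?_, fun r => ?_⟩,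
    ⟨fun r s h => ?_, ∅, by simp, fun s t _ _ => ⟨k, d, hd, fun r _ => rfl⟩⟩, fun r => rfl⟩
  · simp only
    field_simp
    ring
  · simp only
    field_simp
    ring
  · change 2 ^ k * r + d ≤ 2 ^ k * s + d
    gcongr

/-- Two maps agreeing at a dyadic point can be glued there. -/
theorem exists_glue {f g : Equiv.Perm ℝ} (hf : DyadicPL f) (hg : DyadicPL g) {q : ℝ}
    (hq : IsDyadic q) (h : f q = g q) :
    ∃ h : Equiv.Perm ℝ, DyadicPL h ∧ (∀ r ≤ q, h r = f r) ∧ ∀ r, q ≤ r → h r = g r := by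
  have hf' := perm_strictMono hf.1
  have hg' := perm_strictMono hg.1
  set F : ℝ → ℝ := fun r => if r ≤ q then f r else g r with hF
  have h₁ : ∀ r ≤ q, F r = f r := fun r hr => if_pos hr
  have h₂ : ∀ r, q ≤ r → F r = g r := by
    intro r hr
    rcases hr.eq_or_lt with rfl | hlt
    · rw [h₁ _ le_rfl, h]
    · exact if_neg (not_le.2 hlt)
  have hmono : StrictMono F := by
    intro r s hrs
    rcases le_total s q with hs | hs
    · rw [h₁ r (hrs.le.trans hs), h₁ s hs]
      exact hf' hrs
    · rcases le_total r q with hr | hr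
      · rw [h₁ r hr, h₂ s hs]
        rcases hs.eq_or_lt with rfl | hlt
        · rw [← h]
          exact hf' hrs
        · exact ((hf.1 hr).trans_eq h).trans_lt (hg' hlt)
      · rw [h₂ r hr, h₂ s hs]
        exact hg' hrs
  have hsurj : Function.Surjective F := by
    intro w
    rcases le_total w (f q) with hw | hw
    · obtain ⟨r, rfl⟩ := f.surjective w
      exact ⟨r, h₁ r (hf'.le_iff_le.1 hw)⟩
    · rw [h] at hw
      obtain ⟨r, rfl⟩ := g.surjective w
      exact ⟨r, h₂ r (hg'.le_iff_le.1 hw)⟩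
  obtain ⟨P, hP, hfP⟩ := hf.2
  obtain ⟨Q, hQ, hgQ⟩ := hg.2
  refine ⟨Equiv.ofBijective F ⟨hmono.injective, hsurj⟩, ⟨hmono.monotone, insert q (P ∪ Q),
    fun p hp => ?_, fun s t hst hp => ?_⟩, h₁, h₂⟩
  · simp only [Finset.mem_insert, Finset.mem_union] at hp
    rcases hp with rfl | hp | hp
    exacts [hq, hP p hp, hQ p hp]
  · rcases le_or_gt t q with htq | htq
    · obtain ⟨k, d, hd, hk⟩ := hfP s t hst fun p h => hp p (by simp [h])
      exact ⟨k, d, hd, fun r hr => (h₁ r (hr.2.trans htq)).trans (hk r hr)⟩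
    · have hqs : q ≤ s := not_lt.1 fun hlt => hp q (by simp) ⟨hlt, htq⟩
      obtain ⟨k, d, hd, hk⟩ := hgQ s t hst fun p h => hp p (by simp [h])
      exact ⟨k, d, hd, fun r hr => (h₂ r (hqs.trans hr.1)).trans (hk r hr)⟩

/-- Dyadic intervals are equivalent. -/
theorem exists_map_interval {a b c d : ℝ} (ha : IsDyadic a) (hb : IsDyadic b) (hc : IsDyadic c)
    (hd : IsDyadic d) (hab : a < b) (hcd : c < d) :
    ∃ f : Equiv.Perm ℝ, DyadicPL f ∧ f a = c ∧ f b = d := by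
  have hα : 0 < b - a := sub_pos.2 hab
  obtain ⟨n, hn₁, hn₂⟩ := exists_mem_Ico_zpow (div_pos (sub_pos.2 hcd) hα) (one_lt_two (α := ℝ))
  have h2 : (0 : ℝ) < 2 ^ n := by positivity
  rw [le_div_iff₀ hα] at hn₁
  rw [div_lt_iff₀ hα, zpow_add_one₀ two_ne_zero] at hn₂
  set u := 2 ^ (-n) * (d - c) - (b - a) with hu
  have hun : 2 ^ n * u = (d - c) - 2 ^ n * (b - a) := by
    rw [hu, zpow_neg]
    field_simp
  have hu₀ : 0 ≤ u := by
    by_contra! hneg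
    nlinarith
  have hu₁ : u ≤ b - a := by
    by_contra! hlt
    nlinarith
  have hud : IsDyadic u := ((IsDyadic.zpow _).mul (hd.sub hc)).sub (hb.sub ha)
  obtain ⟨f, hf, hf'⟩ := exists_affine (n + 1) (hc.sub ((IsDyadic.zpow (n + 1)).mul ha))
  obtain ⟨g, hg, hg'⟩ := exists_affine n (hd.sub ((IsDyadic.zpow n).mul hb))
  obtain ⟨h, hh, h₁, h₂⟩ := exists_glue hf hg (ha.add hud) (by
    rw [hf', hg', zpow_add_one₀ two_ne_zero]
    linear_combination hun)
  refine ⟨h, hh, ?_, ?_⟩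
  · rw [h₁ a (by linarith), hf']
    ring
  · rw [h₂ b (by linarith), hg']
    ring

/-- A dyadic piecewise linear bump with prescribed support and one prescribed value. -/
theorem exists_bump {p q r s : ℝ} (hp : IsDyadic p) (hq : IsDyadic q) (hr : IsDyadic r)
    (hs : IsDyadic s) (hpq : p < q) (hqs : q < s) (hpr : p < r) (hrs : r < s) :
    ∃ h : Equiv.Perm ℝ, DyadicPL h ∧ h q = r ∧ ∀ z, z ∉ Ioo p s → h z = z := by
  obtain ⟨f, hf, hf₁, hf₂⟩ := exists_map_interval hp hq hp hr hpq hpr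
  obtain ⟨g, hg, hg₁, hg₂⟩ := exists_map_interval hq hs hr hs hqs hrs
  obtain ⟨k, hk, hk₁, hk₂⟩ := exists_glue hg one hs hg₂
  obtain ⟨l, hl, hl₁, hl₂⟩ := exists_glue hf hk hq (by rw [hf₂, hk₁ q hqs.le, hg₁])
  obtain ⟨h, hh, hh₁, hh₂⟩ := exists_glue one hl hp (by rw [hl₁ p hpq.le, hf₁]; rfl)
  refine ⟨h, hh, ?_, fun z hz => ?_⟩
  · rw [hh₂ q hpq.le, hl₁ q le_rfl, hf₂]
  · rcases le_or_gt z p with hzp | hzp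
    · exact hh₁ z hzp
    · have hsz : s ≤ z := not_lt.1 fun hlt => hz ⟨hzp, hlt⟩
      rw [hh₂ z hzp.le, hl₂ z (hqs.le.trans hsz), hk₂ z hsz]
      rfl

/-- The subgroup of dyadic piecewise linear permutations of the line. -/
def subgroup : Subgroup (Equiv.Perm ℝ) where
  carrier := {f | DyadicPL f}
  mul_mem' := mul
  one_mem' := one
  inv_mem' := inv

open Classical in
theorem inThompsonF {f : Homeo01} (hf : DyadicPL (Equiv.Perm.ofSubtype f)) : InThompsonF f := by
  have happ : ∀ s : UI, Equiv.Perm.ofSubtype f (s : ℝ) = f s := fun s =>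
    Equiv.Perm.ofSubtype_apply_coe f s
  obtain ⟨P, hP, h⟩ := hf.2
  refine ⟨fun s t hst => ?_, ?_⟩
  · have := hf.1 (show (s : ℝ) ≤ t from hst)
    rwa [happ, happ] at this
  · set Q : Finset ℝ := insert 0 (insert 1 (P.filter fun p => 0 < p ∧ p < 1)) with hQ
    have h0 : (0 : ℝ) ∈ Q := by simp [hQ]
    have h1 : (1 : ℝ) ∈ Q := by simp [hQ]
    have hQ' : ∀ q ∈ Q, q ∈ Icc (0 : ℝ) 1 ∧ IsDyadic q := by
      intro q hq
      simp only [hQ, Finset.mem_insert, Finset.mem_filter] at hq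
      rcases hq with rfl | rfl | ⟨hq, hq₁, hq₂⟩
      · exact ⟨⟨le_rfl, zero_le_one⟩, IsDyadic.zero⟩
      · exact ⟨⟨zero_le_one, le_rfl⟩, IsDyadic.one⟩
      · exact ⟨⟨hq₁.le, hq₂.le⟩, hP q hq⟩
    obtain ⟨n, hn⟩ : ∃ n, Q.card = n + 1 :=
      Nat.exists_eq_succ_of_ne_zero (Finset.card_ne_zero_of_mem h0)
    set t := Q.orderEmbOfFin hn with ht
    have hmem : ∀ i, t i ∈ Q := fun i => Finset.orderEmbOfFin_mem Q hn i
    have hex : ∀ q ∈ Q, ∃ i, t i = q := fun q hq => by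
      have : q ∈ Set.range t := by rw [ht, Finset.range_orderEmbOfFin]; exact hq
      exact this
    refine ⟨n, t, t.strictMono, ?_, ?_, fun i => (hQ' _ (hmem i)).2, fun i => ?_⟩
    · obtain ⟨i, hi⟩ := hex 0 h0
      exact le_antisymm (hi ▸ t.monotone (Fin.zero_le i)) (hQ' _ (hmem 0)).1.1
    · obtain ⟨i, hi⟩ := hex 1 h1
      exact le_antisymm (hQ' _ (hmem _)).1.2 (hi ▸ t.monotone (Fin.le_last i))
    · obtain ⟨k, d, -, hk⟩ := h (t i.castSucc) (t i.succ)
        (t.monotone (Fin.castSucc_lt_succ).le) fun p hp hlt => by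
          have hpQ : p ∈ Q := by
            simp only [hQ, Finset.mem_insert, Finset.mem_filter]
            exact Or.inr (Or.inr ⟨hp, (hQ' _ (hmem _)).1.1.trans_lt hlt.1,
              hlt.2.trans_le (hQ' _ (hmem _)).1.2⟩)
          obtain ⟨j, rfl⟩ := hex p hpQ
          rw [t.lt_iff_lt, t.lt_iff_lt, Fin.lt_def, Fin.lt_def] at hlt
          simp at hlt
          omega
      exact ⟨k, d, fun s hs₁ hs₂ => by rw [← happ]; exact hk s ⟨hs₁, hs₂⟩⟩

end DyadicPL

/-! ### Realising finite families of bumps by dyadic piecewise linear maps -/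

/-- Dyadic piecewise linear maps with disjoint supports have a common extension. -/
theorem DyadicPL.exists_union {κ : Type*} {h : κ → Equiv.Perm ℝ} (hh : ∀ i, DyadicPL (h i))
    {x y : κ → ℝ} (hfix : ∀ i, ∀ z ∉ Ioo (x i) (y i), h i z = z)
    (T : Finset κ) (hT : ∀ i ∈ T, ∀ j ∈ T, i ≠ j → y i ≤ x j ∨ y j ≤ x i) :
    ∃ g : Equiv.Perm ℝ, DyadicPL g ∧ (∀ i ∈ T, ∀ z ∈ Icc (x i) (y i), g z = h i z) ∧
      ∀ z, (∀ i ∈ T, z ∉ Ioo (x i) (y i)) → g z = z := by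
  classical
  induction T using Finset.induction_on with
  | empty => exact ⟨1, one, by simp, fun z _ => rfl⟩
  | insert i T hi ih =>
    obtain ⟨g, hg, hg₁, hg₂⟩ := ih fun a ha b hb => hT a (Finset.mem_insert_of_mem ha) b
      (Finset.mem_insert_of_mem hb)
    have hdisj : ∀ a ∈ T, ∀ z ∈ Icc (x a) (y a), z ∉ Ioo (x i) (y i) := by
      intro a ha z hz hz'
      rcases hT a (Finset.mem_insert_of_mem ha) i (Finset.mem_insert_self _ _)
        (fun h => hi (h ▸ ha)) with h | h
      · exact absurd (hz'.1.trans_le (hz.2.trans h)) (lt_irrefl _)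
      · exact absurd (hz'.2.trans_le (h.trans hz.1)) (lt_irrefl _)
    have hdisj' : ∀ a ∈ T, ∀ z ∈ Icc (x i) (y i), z ∉ Ioo (x a) (y a) := by
      intro a ha z hz hz'
      rcases hT a (Finset.mem_insert_of_mem ha) i (Finset.mem_insert_self _ _)
        (fun h => hi (h ▸ ha)) with h | h
      · exact absurd (hz'.2.trans_le (h.trans hz.1)) (lt_irrefl _)
      · exact absurd (hz'.1.trans_le (hz.2.trans h)) (lt_irrefl _)
    refine ⟨h i * g, (hh i).mul hg, fun a ha z hz => ?_, fun z hz => ?_⟩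
    · rw [Equiv.Perm.mul_apply]
      rcases Finset.mem_insert.1 ha with rfl | ha
      · rw [hg₂ z fun b hb => hdisj' b hb z hz]
      · rw [hg₁ a ha z hz]
        refine hfix i _ (hdisj a ha _ ⟨?_, ?_⟩)
        · exact (hfix a (x a) fun h => lt_irrefl _ h.1).symm.trans_le ((hh a).1 hz.1)
        · exact ((hh a).1 hz.2).trans_eq (hfix a (y a) fun h => lt_irrefl _ h.2)
    · rw [Equiv.Perm.mul_apply, hg₂ z fun a ha => hz a (Finset.mem_insert_of_mem ha)]
      exact hfix i z (hz i (Finset.mem_insert_self _ _))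

/-- A finite subset of a linear order can be moved to the dyadic rationals of `[0, 1]`. -/
theorem exists_monotone_dyadic {Ω : Type*} [LinearOrder Ω] (P : Finset Ω) :
    ∃ ψ : Ω → ℝ, Monotone ψ ∧ (∀ z, IsDyadic (ψ z) ∧ ψ z ∈ Icc (0 : ℝ) 1) ∧
      ∀ p ∈ P, ∀ z < p, ψ z < ψ p := by
  have h2 : (0 : ℝ) < 2 ^ P.card := by positivity
  refine ⟨fun z => ((P.filter (· ≤ z)).card : ℝ) / 2 ^ P.card, fun z w hzw => ?_,
    fun z => ⟨⟨(P.filter (· ≤ z)).card, P.card, by simp⟩, by positivity, ?_⟩, fun p hp z hz => ?_⟩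
  · simp only
    gcongr
  · rw [div_le_one h2]
    exact_mod_cast (Finset.card_filter_le _ _).trans Nat.lt_two_pow_self.le
  · simp only
    gcongr
    refine (Finset.ssubset_iff_of_subset ?_).2 ⟨p, ?_, ?_⟩
    · exact Finset.monotone_filter_right _ fun w _ hw => le_trans hw hz.le
    · exact Finset.mem_filter.2 ⟨hp, le_rfl⟩
    · exact fun h => absurd (Finset.mem_filter.1 h).2 (not_le.2 hz)

namespace BumpFamily

variable {J ι Ω : Type*} [LinearOrder Ω]

/-- The points `x`, `m`, `d`, `y` of a set of bumps. -/
def points (B : BumpFamily J ι Ω) (K : Set ι) : Set Ω :=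
  ⋃ k ∈ K, {B.x k, B.m k, B.d k, B.y k}

/-- `Y` is a copy on the line of the bumps of `B` with indices in `K`. -/
structure IsCopy (B : BumpFamily J ι Ω) (K : Set ι) (ψ : Ω → ℝ) (Y : BumpFamily J K ℝ) : Prop where
  mono : Monotone ψ
  lt : ∀ p ∈ B.points K, ∀ z < p, ψ z < ψ p
  lab : ∀ k, Y.lab k = B.lab k
  x : ∀ k, Y.x k = ψ (B.x k)
  m : ∀ k, Y.m k = ψ (B.m k)
  d : ∀ k, Y.d k = ψ (B.d k)
  y : ∀ k, Y.y k = ψ (B.y k)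

theorem mem_points (B : BumpFamily J ι Ω) {K : Set ι} {k : ι} (hk : k ∈ K) :
    B.x k ∈ B.points K ∧ B.m k ∈ B.points K ∧ B.d k ∈ B.points K ∧ B.y k ∈ B.points K := by
  refine ⟨?_, ?_, ?_, ?_⟩ <;> exact mem_biUnion hk (by simp)

theorem finite_points (B : BumpFamily J ι Ω) {K : Set ι} (hK : K.Finite) :
    (B.points K).Finite :=
  hK.biUnion fun _ _ => by simp

/-- Finite families of bumps have copies generated by elements of Thompson's group. -/
theorem exists_copy (B : BumpFamily J ι Ω) {K : Set ι} (hK : K.Finite) :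
    ∃ (ψ : Ω → ℝ) (Y : BumpFamily J K ℝ), IsCopy B K ψ Y ∧ ∀ j, DyadicPL (Y.gen j) ∧
      ∀ z ∉ Icc (0 : ℝ) 1, Y.gen j z = z := by
  classical
  have := hK.fintype
  obtain ⟨ψ, hmono, hψ, hlt⟩ := exists_monotone_dyadic (B.finite_points hK).toFinset
  have hlt : ∀ p ∈ B.points K, ∀ z < p, ψ z < ψ p := fun p hp => hlt p (by simpa using hp)
  have hmem := fun k : K => B.mem_points k.2
  have hxm : ∀ k : K, ψ (B.x k) < ψ (B.m k) := fun k => hlt _ (hmem k).2.1 _ (B.x_lt_m k)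
  have hmd : ∀ k : K, ψ (B.m k) < ψ (B.d k) := fun k => hlt _ (hmem k).2.2.1 _ (B.m_lt_d k)
  have hdy : ∀ k : K, ψ (B.d k) < ψ (B.y k) := fun k => hlt _ (hmem k).2.2.2 _ (B.d_lt_y k)
  choose h hh hhm hhfix using fun k : K => DyadicPL.exists_bump (hψ (B.x k)).1 (hψ (B.m k)).1
    (hψ (B.d k)).1 (hψ (B.y k)).1 (hxm k) ((hmd k).trans (hdy k)) ((hxm k).trans (hmd k)) (hdy k)
  set h' : K → Equiv.Perm ℝ := fun k => cond (B.lab k).2 (h k) (h k)⁻¹ with hh'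
  have hxy : ∀ k : K, ψ (B.x k) < ψ (B.y k) := fun k => (hxm k).trans ((hmd k).trans (hdy k))
  have horb : ∀ i k : K, i ≠ k → (B.lab i).1 = (B.lab k).1 →
      ψ (B.y i) ≤ ψ (B.x k) ∨ ψ (B.y k) ≤ ψ (B.x i) := fun i k hne hl =>
    (B.orb_le i k (fun h => hne (Subtype.ext h)) hl).imp (fun h => hmono h) fun h => hmono h
  choose g hg hg₁ hg₂ using fun j => DyadicPL.exists_union (h := h')
    (fun k => by
      simp only [hh']
      cases (B.lab k).2
      exacts [(hh k).inv, hh k])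
    (fun k z hz => by
      simp only [hh']
      cases (B.lab k).2
      exacts [Equiv.Perm.inv_eq_iff_eq.2 (hhfix k z hz).symm, hhfix k z hz])
    (Finset.univ.filter fun k : K => (B.lab k).1 = j) fun i hi k hk hne => horb i k hne
      ((Finset.mem_filter.1 hi).2.trans (Finset.mem_filter.1 hk).2.symm)
  have hact : ∀ (k : K) (z w : ℝ), z ∈ Icc (ψ (B.x k)) (ψ (B.y k)) →
      w ∈ Icc (ψ (B.x k)) (ψ (B.y k)) → h k z = w → letterAct g (B.lab k) z = w := by
    intro k z w hz hw hzw
    have hgz := hg₁ (B.lab k).1 k (by simp)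
    cases hb : (B.lab k).2 <;> simp only [letterAct, hh', hb, cond_true, cond_false] at hgz ⊢
    · refine Equiv.Perm.inv_eq_iff_eq.2 ?_
      rw [hgz w hw]
      exact (Equiv.Perm.inv_eq_iff_eq.2 hzw.symm).symm
    · exact (hgz z hz).trans hzw
  have hfilt : ∀ j z, (∀ k : K, (B.lab k).1 = j → z ∉ Ioo (ψ (B.x k)) (ψ (B.y k))) → g j z = z :=
    fun j z hz => hg₂ j z fun k hk => hz k (Finset.mem_filter.1 hk).2
  refine ⟨ψ, {
    gen := g
    gen_mono := fun j => (hg j).1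
    lab := fun k => B.lab k
    x := fun k => ψ (B.x k)
    m := fun k => ψ (B.m k)
    d := fun k => ψ (B.d k)
    y := fun k => ψ (B.y k)
    x_lt_m := hxm
    m_lt_d := hmd
    d_lt_y := hdy
    foot_le := fun s t hst => ?_
    orb_le := horb
    act_x := fun k => hact k _ _ ⟨le_rfl, (hxy k).le⟩ ⟨le_rfl, (hxy k).le⟩
      (hhfix k _ fun h => lt_irrefl _ h.1)
    act_m := fun k => hact k _ _ ⟨(hxm k).le, ((hmd k).trans (hdy k)).le⟩
      ⟨((hxm k).trans (hmd k)).le, (hdy k).le⟩ (hhm k)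
    act_y := fun k => hact k _ _ ⟨(hxy k).le, le_rfl⟩ ⟨(hxy k).le, le_rfl⟩
      (hhfix k _ fun h => lt_irrefl _ h.2)
    fix := hfilt },
    ⟨hmono, hlt, fun _ => rfl, fun _ => rfl, fun _ => rfl, fun _ => rfl, fun _ => rfl⟩,
    fun j => ⟨hg j, fun z hz => hfilt j z fun k _ hzk => hz ?_⟩⟩
  · have hne : ((s.1 : ι), s.2) ≠ ((t.1 : ι), t.2) := fun h => hst (by
      rw [Prod.mk.injEq] at h
      exact Prod.ext (Subtype.ext h.1) h.2)
    have := B.foot_le _ _ hne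
    rcases s with ⟨i, _ | _⟩ <;> rcases t with ⟨k, _ | _⟩ <;>
      exact this.imp (fun h => hmono h) fun h => hmono h
  · exact ⟨(hψ _).2.1.trans hzk.1.le, hzk.2.le.trans (hψ _).2.2⟩

end BumpFamily

/-! ### Merging isolated bumps -/

namespace BumpFamily

variable {J ι Ω : Type*} [LinearOrder Ω]

/-- The retraction `r` merges isolated bumps with the same label whose feet have the same position
relative to the bumps that are not isolated. -/
structure IsMerging (B : BumpFamily J ι Ω) (r : ι → ι) : Prop where
  idem : ∀ a, r (r a) = r a
  lab : ∀ a, B.lab (r a) = B.lab a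
  isolated : ∀ a, r a ≠ a → B.Isolated a ∧ B.Isolated (r a)
  inside : ∀ a b c, ¬ B.Isolated c → (B.Inside (r a, b) c ↔ B.Inside (a, b) c)

theorem exists_merging [Finite J] (B : BumpFamily J ι Ω) (hfin : {c | ¬ B.Isolated c}.Finite) :
    ∃ r, IsMerging B r ∧ (range r).Finite := by
  classical
  have : Finite {c | ¬ B.Isolated c} := hfin
  set key : ι → {c | ¬ B.Isolated c} ⊕ (J × Bool) × Set ({c | ¬ B.Isolated c} × Bool) := fun a =>
    if h : B.Isolated a then Sum.inr (B.lab a, {p | B.Inside (a, p.2) p.1}) else Sum.inl ⟨a, h⟩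
    with hkey
  set r : ι → ι := fun a => Function.surjInv (rangeFactorization_surjective (f := key))
    (rangeFactorization key a) with hr
  have hkr : ∀ a, key (r a) = key a := fun a =>
    congrArg Subtype.val (Function.surjInv_eq (rangeFactorization_surjective (f := key))
      (rangeFactorization key a))
  have hcases : ∀ a, r a = a ∨ (B.Isolated a ∧ B.Isolated (r a) ∧ B.lab (r a) = B.lab a ∧
      ∀ b c, ¬ B.Isolated c → (B.Inside (r a, b) c ↔ B.Inside (a, b) c)) := by
    intro a
    have h := hkr a
    by_cases h₁ : B.Isolated (r a) <;> by_cases h₂ : B.Isolated a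
    · simp only [hkey, h₁, h₂, dif_pos, Sum.inr.injEq, Prod.mk.injEq] at h
      refine Or.inr ⟨h₂, h₁, h.1, fun b c hc => ?_⟩
      exact Set.ext_iff.1 h.2 (⟨c, hc⟩, b)
    · simp [hkey, h₁, h₂] at h
    · simp [hkey, h₁, h₂] at h
    · simp only [hkey, h₁, h₂, dif_neg, not_false_eq_true, Sum.inl.injEq, Subtype.mk.injEq] at h
      exact Or.inl h
  refine ⟨r, ⟨fun a => ?_, fun a => ?_, fun a ha => ?_, fun a b c hc => ?_⟩, ?_⟩
  · have : rangeFactorization key (r a) = rangeFactorization key a := Subtype.ext (hkr a)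
    simp only [hr] at this ⊢
    rw [this]
  · rcases hcases a with h | h
    · rw [h]
    · exact h.2.2.1
  · rcases hcases a with h | h
    · exact absurd h ha
    · exact ⟨h.1, h.2.1⟩
  · rcases hcases a with h | h
    · rw [h]
    · exact h.2.2.2 b c hc
  · have : Finite (range key) := inferInstance
    refine (finite_range (Function.surjInv (rangeFactorization_surjective (f := key)))).subset ?_
    rintro _ ⟨a, rfl⟩
    exact ⟨_, rfl⟩

namespace IsMerging

variable {B : BumpFamily J ι Ω} {r : ι → ι}

theorem isolated_apply (hr : IsMerging B r) {a : ι} (ha : B.Isolated a) : B.Isolated (r a) := by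
  by_cases h : r a = a
  · rwa [h]
  · exact (hr.isolated a h).2

theorem eq_of_not_isolated (hr : IsMerging B r) {a : ι} (ha : ¬ B.Isolated a) : r a = a := by
  by_contra h
  exact ha (hr.isolated a h).1

theorem eq_of_mem_range (hr : IsMerging B r) {k : ι} (hk : k ∈ range r) : r k = k := by
  obtain ⟨a, rfl⟩ := hk
  exact hr.idem a

theorem inside_apply (hr : IsMerging B r) {a c : ι} {b : Bool} (h : B.Inside (a, b) c) :
    B.Inside (r a, b) (r c) := by
  by_cases hc : B.Isolated c
  · obtain rfl : a = c := hc _ h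
    exact B.inside_self (r a, b)
  · rw [hr.eq_of_not_isolated hc, hr.inside a b c hc]
    exact h

theorem exists_inside (hr : IsMerging B r) {a k : ι} {b : Bool} (hk : k ∈ range r)
    (h : B.Inside (r a, b) k) :
    ∃ c, r c = k ∧ B.Inside (a, b) c := by
  by_cases hc : B.Isolated k
  · exact ⟨a, hc _ h, B.inside_self (a, b)⟩
  · exact ⟨k, hr.eq_of_mem_range hk, (hr.inside a b k hc).1 h⟩

/-- A bump which contains a foot of another bump is not merged. -/
theorem eq_of_inside (hr : IsMerging B r) {a c : ι} {b : Bool} (hne : a ≠ c)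
    (h : B.Inside (a, b) c) : r c = c :=
  hr.eq_of_not_isolated fun hc => hne (hc _ h)

end IsMerging

theorem inside_of_lt (B : BumpFamily J ι Ω) {e c : ι} (h : B.x c < B.x e ∧ B.y e < B.y c)
    (b : Bool) : B.Inside (e, b) c :=
  ⟨h.1.le.trans (B.x_le_lo (e, b)), (B.hi_le_y (e, b)).trans h.2.le⟩

namespace IsCopy

variable {B : BumpFamily J ι Ω} {K : Set ι} {ψ : Ω → ℝ} {Y : BumpFamily J K ℝ}

theorem le_iff (hY : IsCopy B K ψ Y) {p z : Ω} (hp : p ∈ B.points K) : ψ p ≤ ψ z ↔ p ≤ z :=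
  ⟨fun h => not_lt.1 fun hlt => absurd (hY.lt p hp z hlt) (not_lt.2 h), fun h => hY.mono h⟩

theorem lt_iff (hY : IsCopy B K ψ Y) {p z : Ω} (hp : p ∈ B.points K) : ψ z < ψ p ↔ z < p := by
  rw [← not_le, ← not_le, hY.le_iff hp]

theorem inside_iff (hY : IsCopy B K ψ Y) (s : K × Bool) (k : K) :
    Y.Inside s k ↔ B.Inside ((s.1 : ι), s.2) k := by
  obtain ⟨hx, -, -, -⟩ := B.mem_points k.2
  rcases s with ⟨i, _ | _⟩
  · obtain ⟨-, hm, -, -⟩ := B.mem_points i.2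
    simp only [Inside, lo, hi, cond_false, hY.x, hY.y, hY.m]
    rw [hY.le_iff hx, hY.le_iff hm]
  · obtain ⟨-, -, -, hy⟩ := B.mem_points i.2
    simp only [Inside, lo, hi, cond_true, hY.x, hY.y, hY.d]
    rw [hY.le_iff hx, hY.le_iff hy]

theorem label (hY : IsCopy B K ψ Y) (s : K × Bool) : Y.label s = B.label ((s.1 : ι), s.2) := by
  simp only [BumpFamily.label, hY.lab]

theorem mem_orb_of_mem_orb (hY : IsCopy B K ψ Y) {k : K} {z : Ω} (h : ψ z ∈ Ioo (Y.x k) (Y.y k)) :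
    z ∈ Ioo (B.x k) (B.y k) := by
  rw [hY.x, hY.y] at h
  exact ⟨hY.mono.reflect_lt h.1, hY.mono.reflect_lt h.2⟩

end IsCopy

/-- Points have corresponding positions with respect to the bumps of a family and the bumps of a
copy of its quotient under a merging. -/
def PointRel (B : BumpFamily J ι Ω) (r : ι → ι) (Y : BumpFamily J (range r) ℝ) (z : Ω) (z' : ℝ) :
    Prop :=
  (∀ a, z ∈ Ioo (B.x a) (B.y a) → z' ∈ Ioo (Y.x ⟨r a, a, rfl⟩) (Y.y ⟨r a, a, rfl⟩)) ∧
    ∀ k, z' ∈ Ioo (Y.x k) (Y.y k) → ∃ a, r a = k ∧ z ∈ Ioo (B.x a) (B.y a)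

section

variable {B : BumpFamily J ι Ω} {r : ι → ι} {ψ : Ω → ℝ} {Y : BumpFamily J (range r) ℝ}

theorem exists_pointRel (hr : IsMerging B r) (hY : IsCopy B (range r) ψ Y) {z : Ω}
    (hz : ∀ s, z ∉ B.foot s) : ∃ z', (∀ s, z' ∉ Y.foot s) ∧ PointRel B r Y z z' := by
  by_cases hex : ∃ e, B.Isolated e ∧ z ∈ Ioo (B.x e) (B.y e)
  · obtain ⟨e, he, hze⟩ := hex
    have hre := hr.isolated_apply he
    set l : range r := ⟨r e, e, rfl⟩ with hl
    have hm : Y.m l ∈ Ioo (Y.x l) (Y.y l) := ⟨Y.x_lt_m l, Y.m_lt_y l⟩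
    refine ⟨Y.m l, fun s hs => ?_, fun a ha => ?_, fun k hk => ?_⟩
    · have hin := Y.inside_of_mem (Y.foot_subset_Ico s hs) hm
      rw [hY.inside_iff] at hin
      have hsl : s.1 = l := Subtype.ext (hre _ hin)
      rcases s with ⟨i, _ | _⟩
      · simp only at hsl
        subst hsl
        exact lt_irrefl _ hs.2
      · simp only at hsl
        subst hsl
        exact absurd (Y.m_lt_d _) (not_lt.2 hs.1)
    · by_cases hae : a = e
      · subst hae
        exact hm
      · have hin := B.inside_of_lt (he.lt B hae hze ha)
        have hra := hr.eq_of_inside (Ne.symm hae) (hin true)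
        have h₁ := (hr.inside_apply (hin false)).1
        have h₂ := (hr.inside_apply (hin true)).2
        refine ⟨lt_of_le_of_lt ?_ hm.1, lt_of_lt_of_le hm.2 ?_⟩
        · rw [hY.x, hY.x]
          exact hY.mono h₁
        · rw [hY.y, hY.y]
          exact hY.mono h₂
    · rw [hY.m] at hk
      have hmk := hY.mem_orb_of_mem_orb hk
      have hrk := hr.eq_of_mem_range k.2
      by_cases hke : (k : ι) = r e
      · exact ⟨e, hke.symm, hze⟩
      · have hlt := hre.lt B hke (z := B.m (r e)) ⟨B.x_lt_m _, B.m_lt_y _⟩ hmk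
        have hin := B.inside_of_lt hlt
        have hni : ¬ B.Isolated k := fun h => hke (h _ (hin true)).symm
        refine ⟨k, hrk, ?_⟩
        have h₁ := ((hr.inside e false k hni).1 (hin false)).1
        have h₂ := ((hr.inside e true k hni).1 (hin true)).2
        exact ⟨lt_of_le_of_lt h₁ hze.1, lt_of_lt_of_le hze.2 h₂⟩
  · push Not at hex
    have hfix : ∀ a, z ∈ Ioo (B.x a) (B.y a) → r a = a := fun a ha =>
      hr.eq_of_not_isolated fun h => hex a h ha
    refine ⟨ψ z, ?_, fun a ha => ?_, fun k hk => ?_⟩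
    · rintro ⟨k, _ | _⟩ hs
      · have hs : Y.x k < ψ z ∧ ψ z < Y.m k := hs
        rw [hY.x, hY.m, hY.lt_iff (B.mem_points k.2).2.1] at hs
        exact hz (k, false) ⟨hY.mono.reflect_lt hs.1, hs.2⟩
      · have hs : Y.d k ≤ ψ z ∧ ψ z < Y.y k := hs
        rw [hY.d, hY.y, hY.lt_iff (B.mem_points k.2).2.2.2,
          hY.le_iff (B.mem_points k.2).2.2.1] at hs
        exact hz (k, true) hs
    · have hmz : B.m a ≤ z := not_lt.1 fun h => hz (a, false) ⟨ha.1, h⟩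
      have hra := hfix a ha
      have hmem := B.mem_points (K := range r) ⟨a, rfl⟩
      rw [hY.x, hY.y, mem_Ioo, hY.lt_iff hmem.2.2.2]
      simp only [hra] at hmem ⊢
      exact ⟨(hY.lt _ hmem.2.1 _ (B.x_lt_m a)).trans_le (hY.mono hmz), ha.2⟩
    · exact ⟨k, hr.eq_of_mem_range k.2, hY.mem_orb_of_mem_orb hk⟩

theorem exists_pointRel' [OrderBot Ω] [DenselyOrdered Ω] (hr : IsMerging B r)
    (hfin : (range r).Finite) (hY : IsCopy B (range r) ψ Y) {z' : ℝ} (hz' : ∀ s, z' ∉ Y.foot s) :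
    ∃ z, (∀ s, z ∉ B.foot s) ∧ PointRel B r Y z z' := by
  by_cases hS : {p ∈ B.points (range r) | ψ p ≤ z'}.Nonempty
  · obtain ⟨p, ⟨hp, hpz⟩, hmax⟩ :=
      ((B.finite_points hfin).subset (sep_subset _ _)).exists_maximal hS
    have hle : ∀ q ∈ B.points (range r), q ≤ p ↔ ψ q ≤ z' := fun q hq =>
      ⟨fun h => (hY.mono h).trans hpz, fun h => (le_total q p).elim id fun h' => hmax ⟨hq, h⟩ h'⟩
    have hlt : ∀ q ∈ B.points (range r), p < q ↔ z' < ψ q := fun q hq => by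
      rw [← not_le, ← not_le, hle q hq]
    have hpfoot : ∀ (k : range r) b, p ∉ B.foot ((k : ι), b) := by
      rintro k (_ | _) hf
      · refine hz' (k, false) ⟨?_, ?_⟩
        · rw [hY.x]
          exact (hY.lt p hp _ hf.1).trans_le hpz
        · rw [hY.m, ← hlt _ (B.mem_points k.2).2.1]
          exact hf.2
      · refine hz' (k, true) ⟨?_, ?_⟩
        · rw [hY.d, ← hle _ (B.mem_points k.2).2.2.1]
          exact hf.1
        · rw [hY.y, ← hlt _ (B.mem_points k.2).2.2.2]
          exact hf.2
    have horb : ∀ k : range r, p ∈ Ioo (B.x k) (B.y k) ↔ z' ∈ Ioo (Y.x k) (Y.y k) := by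
      intro k
      rw [mem_Ioo, mem_Ioo, hY.y, ← hlt _ (B.mem_points k.2).2.2.2]
      refine and_congr_left fun _ => ⟨fun h => ?_, fun h => ?_⟩
      · rw [hY.x]
        exact (hY.lt p hp _ h).trans_le hpz
      · have hm : Y.m k ≤ z' := not_lt.1 fun h' => hz' (k, false) ⟨h, h'⟩
        rw [hY.m, ← hle _ (B.mem_points k.2).2.1] at hm
        exact (B.x_lt_m k).trans_le hm
    by_cases hex : ∃ e, r e ≠ e ∧ p ∈ Ioo (B.x e) (B.y e)
    · obtain ⟨e, hne, hpe⟩ := hex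
      have he := (hr.isolated e hne).1
      refine ⟨B.x e, fun s hs => ?_, fun a ha => ?_, fun k hk => ?_⟩
      · by_cases hse : s = (e, false)
        · subst hse
          exact lt_irrefl _ hs.1
        · have hs' := B.foot_subset_Ico s hs
          rcases B.hi_le_lo hse with h | h
          · exact absurd hs'.2 (not_lt.2 h)
          · exact absurd (B.x_lt_m e) (not_lt.2 (h.trans hs'.1))
      · have hae : a ≠ e := by
          rintro rfl
          exact lt_irrefl _ ha.1
        obtain ⟨w, hw₁, hw₂⟩ := exists_between (lt_min (B.x_lt_y e) ha.2)
        have hlt' := he.lt B hae (z := w) ⟨hw₁, hw₂.trans_le (min_le_left _ _)⟩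
          ⟨ha.1.trans hw₁, hw₂.trans_le (min_le_right _ _)⟩
        have hra := hr.eq_of_inside hae.symm (B.inside_of_lt hlt' true)
        rw [← horb]
        simp only [hra]
        exact ⟨hlt'.1.trans hpe.1, hpe.2.trans hlt'.2⟩
      · have hrk := hr.eq_of_mem_range k.2
        have hke : (k : ι) ≠ e := fun h => hne (h ▸ hrk)
        have hlt' := he.lt B hke hpe ((horb k).2 hk)
        exact ⟨k, hrk, hlt'.1, (B.x_lt_y e).trans hlt'.2⟩
    · push Not at hex
      have hfix : ∀ a, p ∈ Ioo (B.x a) (B.y a) → r a = a := fun a ha => by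
        by_contra h
        exact hex a h ha
      refine ⟨p, fun s hs => ?_, fun a ha => ?_, fun k hk => ?_⟩
      · have := hfix s.1 (B.foot_subset s hs)
        exact hpfoot ⟨s.1, s.1, this⟩ s.2 hs
      · rw [← horb]
        simpa only [hfix a ha] using ha
      · exact ⟨k, hr.eq_of_mem_range k.2, (horb k).2 hk⟩
  · refine ⟨⊥, fun s hs => not_lt_bot (B.foot_subset s hs).1, fun a ha => absurd ha.1 not_lt_bot,
      fun k hk => absurd ?_ hS⟩
    exact ⟨B.x k, (B.mem_points k.2).1, by rw [← hY.x]; exact hk.1.le⟩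

/-- Corresponding cells of a family and a copy of its quotient under a merging. -/
def CellRel (B : BumpFamily J ι Ω) (r : ι → ι) (Y : BumpFamily J (range r) ℝ) :
    (ι × Bool) ⊕ Ω → (range r × Bool) ⊕ ℝ → Prop
  | Sum.inl s, Sum.inl s' => r s.1 = s'.1 ∧ s.2 = s'.2
  | Sum.inr z, Sum.inr z' => PointRel B r Y z z'
  | _, _ => False

theorem CellRel.subset [DenselyOrdered Ω] (hr : IsMerging B r) (hY : IsCopy B (range r) ψ Y)
    {b : (ι × Bool) ⊕ Ω} {b' : (range r × Bool) ⊕ ℝ} (h : CellRel B r Y b b') {c : ι}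
    (hc : B.toSystem.cell b ⊆ B.toSystem.orb c) :
    Y.toSystem.cell b' ⊆ Y.toSystem.orb ⟨r c, c, rfl⟩ := by
  match b, b', h with
  | Sum.inl (a, ε), Sum.inl (k, ε'), h =>
    obtain ⟨h₁, rfl⟩ : r a = k ∧ ε = ε' := h
    refine (Y.inside_iff _ _).2 ((hY.inside_iff _ _).2 ?_)
    simp only [← h₁]
    exact hr.inside_apply ((B.inside_iff _ _).1 hc)
  | Sum.inr z, Sum.inr z', h => exact singleton_subset_iff.2 (h.1 c (hc rfl))

theorem CellRel.exists_subset [DenselyOrdered Ω] (hr : IsMerging B r) (hY : IsCopy B (range r) ψ Y)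
    {b : (ι × Bool) ⊕ Ω} {b' : (range r × Bool) ⊕ ℝ} (h : CellRel B r Y b b') {k : range r}
    (hk : Y.toSystem.cell b' ⊆ Y.toSystem.orb k) :
    ∃ c, r c = k ∧ B.toSystem.cell b ⊆ B.toSystem.orb c := by
  match b, b', h with
  | Sum.inl (a, ε), Sum.inl (l, ε'), h =>
    obtain ⟨h₁, rfl⟩ : r a = l ∧ ε = ε' := h
    have hin := (hY.inside_iff _ _).1 ((Y.inside_iff _ _).1 hk)
    simp only [← h₁] at hin
    obtain ⟨c, hc, hin⟩ := hr.exists_inside k.2 hin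
    exact ⟨c, hc, (B.inside_iff _ _).2 hin⟩
  | Sum.inr z, Sum.inr z', h =>
    obtain ⟨c, hc, hz⟩ := h.2 k (hk rfl)
    exact ⟨c, hc, singleton_subset_iff.2 hz⟩

theorem label_eq_of_rel (hr : IsMerging B r) (hY : IsCopy B (range r) ψ Y) {s : ι × Bool}
    {s' : range r × Bool} (h : r s.1 = s'.1 ∧ s.2 = s'.2) : B.label s = Y.label s' := by
  rw [hY.label, ← h.1, ← h.2]
  simp only [label, hr.lab]

/-- A family is simulated by a copy of its quotient under a merging. -/
def simulation [DenselyOrdered Ω] (hr : IsMerging B r) (hY : IsCopy B (range r) ψ Y) :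
    FastSystem.Simulation B.toSystem Y.toSystem where
  rel := CellRel B r Y
  exists_rel b hb := by
    cases b with
    | inl s => exact ⟨Sum.inl (⟨r s.1, s.1, rfl⟩, s.2), trivial, rfl, rfl⟩
    | inr z =>
      obtain ⟨z', hz', h⟩ := exists_pointRel hr hY hb
      exact ⟨Sum.inr z', hz', h⟩
  exists_label s b' h := by
    cases b' with
    | inl s' => exact ⟨s', rfl, label_eq_of_rel hr hY h⟩
    | inr z' => exact h.elim
  push b b' h s hs hne := by
    refine ⟨(⟨r s.1, s.1, rfl⟩, s.2), CellRel.subset hr hY h hs, ?_, rfl, rfl⟩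
    rintro rfl
    cases b with
    | inr z => exact h
    | inl u =>
      obtain ⟨h₁, h₂⟩ : r u.1 = r s.1 ∧ u.2 = !s.2 := h
      refine hne (congrArg Sum.inl (Prod.ext ?_ h₂))
      by_contra hus
      have hin := (B.inside_iff u s.1).1 hs
      have hni : ¬ B.Isolated s.1 := fun h => hus (h u hin)
      rw [hr.eq_of_not_isolated hni] at h₁
      exact hni (h₁ ▸ (hr.isolated u.1 fun h => hus (h.symm.trans h₁)).2)
  stay b b' h s' hs' := by
    obtain ⟨c, hc, hsub⟩ := CellRel.exists_subset hr hY h hs'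
    exact ⟨(c, s'.2), label_eq_of_rel hr hY ⟨hc, rfl⟩, hsub⟩

/-- A family simulates a copy of its quotient under a merging. -/
def simulation' [OrderBot Ω] [DenselyOrdered Ω] (hr : IsMerging B r) (hfin : (range r).Finite)
    (hY : IsCopy B (range r) ψ Y) : FastSystem.Simulation Y.toSystem B.toSystem where
  rel b' b := CellRel B r Y b b'
  exists_rel b' hb' := by
    cases b' with
    | inl s => exact ⟨Sum.inl ((s.1 : ι), s.2), trivial, hr.eq_of_mem_range s.1.2, rfl⟩
    | inr z' =>
      obtain ⟨z, hz, h⟩ := exists_pointRel' hr hfin hY hb'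
      exact ⟨Sum.inr z, hz, h⟩
  exists_label s' b h := by
    cases b with
    | inl s => exact ⟨s, rfl, (label_eq_of_rel hr hY h).symm⟩
    | inr z => exact h.elim
  push b' b h s' hs' hne := by
    obtain ⟨c, hc, hsub⟩ := CellRel.exists_subset hr hY h hs'
    refine ⟨(c, s'.2), hsub, ?_, hc, rfl⟩
    rintro rfl
    cases b' with
    | inr z => exact h
    | inl u =>
      obtain ⟨h₁, h₂⟩ : r c = u.1 ∧ (!s'.2) = u.2 := h
      exact hne (congrArg Sum.inl (Prod.ext (Subtype.ext (h₁.symm.trans hc)) h₂.symm))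
  stay b' b h s hs :=
    ⟨(⟨r s.1, s.1, rfl⟩, s.2), (label_eq_of_rel hr hY ⟨rfl, rfl⟩).symm, CellRel.subset hr hY h hs⟩

end

end BumpFamily

/-! ### The embedding -/

/-- Two families of permutations with the same relations generate isomorphic groups. -/
theorem exists_injective_of_ker_eq {G H : Type*} [Group G] [Group H] {X : Set G} (h : X → H)
    (hker : (FreeGroup.lift h).ker = (FreeGroup.lift ((↑) : X → G)).ker) :
    ∃ φ : Subgroup.closure X →* H, Function.Injective φ ∧ ∀ g, φ g ∈ (FreeGroup.lift h).range := by
  rw [FreeGroup.closure_eq_range]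
  set e₁ := QuotientGroup.quotientKerEquivRange (FreeGroup.lift ((↑) : X → G))
  set e₂ := QuotientGroup.quotientKerEquivRange (FreeGroup.lift h)
  set e := (e₁.symm.trans (QuotientGroup.quotientMulEquivOfEq hker.symm)).trans e₂
  exact ⟨(FreeGroup.lift h).range.subtype.comp e.toMonoidHom,
    Subtype.val_injective.comp e.injective, fun g => (e g).2⟩

theorem FastSystem.lift_mk {J ι Ω : Type*} (F : FastSystem J ι Ω) (w : List (J × Bool)) :
    FreeGroup.lift F.gen (FreeGroup.mk w) = F.wordAct w :=
  FreeGroup.lift_mk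

theorem FastSystem.Simulation.ker_le {J ι ι' Ω Ω' : Type*} {F : FastSystem J ι Ω}
    {F' : FastSystem J ι' Ω'} (R : Simulation F F') :
    (FreeGroup.lift F'.gen).ker ≤ (FreeGroup.lift F.gen).ker := by
  intro w hw
  induction w using Quot.inductionOn with
  | h w =>
    have hw : FreeGroup.lift F'.gen (FreeGroup.mk w) = 1 := hw
    change FreeGroup.lift F.gen (FreeGroup.mk w) = 1
    rw [FastSystem.lift_mk] at hw ⊢
    exact R.wordAct_eq_one hw

theorem exists_dyadic_generators {X : Set Homeo01} (hX : ∀ f ∈ X, IsOPH f) (hfin : X.Finite)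
    (hfast : GeomFast X) :
    ∃ Y : X → Equiv.Perm ℝ, (∀ j, DyadicPL (Y j) ∧ ∀ z ∉ Icc (0 : ℝ) 1, Y j z = z) ∧
      (FreeGroup.lift Y).ker = (FreeGroup.lift ((↑) : X → Homeo01)).ker := by
  have : Finite X := hfin
  obtain ⟨B, hgen, hsupt⟩ := exists_bumpFamily hX hfast
  have hprop : ∀ j k, j ≠ k → ∀ t,
      ¬ ((IsLeftTransition (B.gen j) t ∧ IsLeftTransition (B.gen k) t) ∨
        (IsRightTransition (B.gen j) t ∧ IsRightTransition (B.gen k) t)) := by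
    intro j k hjk t
    have hjk' : j.1 ≠ k.1 := fun h => hjk (Subtype.ext h)
    rw [hgen, hgen, not_or]
    exact ⟨hfast.1.1 j.1 j.2 k.1 k.2 hjk' t, hfast.1.2 j.1 j.2 k.1 k.2 hjk' t⟩
  obtain ⟨r, hr, hrfin⟩ := B.exists_merging (B.finite_not_isolated hsupt hprop)
  obtain ⟨ψ, Y, hY, hdyadic⟩ := B.exists_copy hrfin
  have hB : B.gen = ((↑) : X → Homeo01) := funext hgen
  refine ⟨Y.gen, hdyadic, ?_⟩
  rw [← hB]
  exact le_antisymm (BumpFamily.simulation hr hY).ker_le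
    (BumpFamily.simulation' hr hrfin hY).ker_le

theorem apply_mem_iff_of_fix {f : Equiv.Perm ℝ} {s : Set ℝ} (h : ∀ z ∉ s, f z = z) (z : ℝ) :
    f z ∈ s ↔ z ∈ s := by
  constructor <;> intro hz <;> by_contra hz'
  · rw [h z hz'] at hz
    exact hz' hz
  · exact hz' (by rwa [f.injective (h _ hz')])

/-- **Corollary (EmbedInF).** Any finite geometrically fast set `X ⊆ Homeo₊(I)`
generates a group which embeds into Thompson's group `F`. -/
theorem embeds_in_thompson_F (X : Set Homeo01)
    (hX : ∀ f ∈ X, IsOPH f) (hfin : X.Finite) (hfast : GeomFast X) :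
    ∃ φ : ↥(Subgroup.closure X) →* Homeo01,
      Function.Injective ⇑φ ∧ ∀ g : ↥(Subgroup.closure X), InThompsonF (φ g) := by
  classical
  obtain ⟨Y, hY, hker⟩ := exists_dyadic_generators hX hfin hfast
  set h : X → Homeo01 := fun j => (Y j).subtypePerm (apply_mem_iff_of_fix (hY j).2) with hh
  have hof : ∀ j, Equiv.Perm.ofSubtype (h j) = Y j := fun j =>
    Equiv.Perm.ofSubtype_subtypePerm (apply_mem_iff_of_fix (hY j).2) fun z hz => by
      by_contra hz'
      exact hz ((hY j).2 z hz')
  have hcomp : Equiv.Perm.ofSubtype.comp (FreeGroup.lift h) = FreeGroup.lift Y :=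
    FreeGroup.ext_hom _ _ fun j => by simp [hof]
  have hker' : (FreeGroup.lift h).ker = (FreeGroup.lift ((↑) : X → Homeo01)).ker := by
    rw [← hker, ← hcomp, MonoidHom.ker_comp_of_injective]
    exact Equiv.Perm.ofSubtype_injective
  obtain ⟨φ, hφ, hrange⟩ := exists_injective_of_ker_eq h hker'
  refine ⟨φ, hφ, fun g => DyadicPL.inThompsonF ?_⟩
  obtain ⟨w, hw⟩ := hrange g
  have hle : (FreeGroup.lift Y).range ≤ DyadicPL.subgroup := by
    rw [FreeGroup.range_lift_eq_closure, Subgroup.closure_le]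
    rintro _ ⟨j, rfl⟩
    exact (hY j).1
  refine hle ⟨w, ?_⟩
  rw [← hcomp, MonoidHom.comp_apply, hw]

end PingPong
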